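/- Let α ∈ ℝ and N ≥ 2, and let ψ : (ℝ²)^N → ℂ be smooth, symmetric, normalized (∫|ψ|² = 1), and with support disjoint from the diagonal set Δ = {x : x_j = x_k for some j ≠ k}. Let ρ(x) := N·∫_{(ℝ²)^{N−1}} |ψ(x, x_2, …, x_N)|² dx_2⋯dx_N be the one-particle density. Then the kinetic energy inequality for anyons holds: (1/2)·∫_{(ℝ²)^N} ∑_{j=1}^N ‖D_j ψ‖² dx ≥ 10⁻⁴ · C_{α,N}² · ∫_{ℝ²} ρ(x)² dx. -/

import Mathlib

open MeasureTheory

/-- The anyonic exclusion constant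
`C_{α,N} = min_{p ∈ {0,…,N-2}, q ∈ ℤ} |(2p+1)α - 2q|`. -/
noncomputable def Calpha (α : ℝ) (n : ℕ) : ℝ :=
  sInf {c : ℝ | ∃ p : ℕ, ∃ q : ℤ, p ≤ n - 2 ∧ c = |(2 * (p : ℝ) + 1) * α - 2 * (q : ℝ)|}

/-- The `i`-th component of the Aharonov–Bohm magnetic potential
`A_j(x) = α ∑_{k ≠ j} (x_j - x_k)^⊥/|x_j - x_k|²` felt by the `j`-th anyon. -/
noncomputable def anyonA (α : ℝ) {n : ℕ} (x : Fin n → EuclideanSpace ℝ (Fin 2))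
    (j : Fin n) (i : Fin 2) : ℝ :=
  α * ∑ k ∈ Finset.univ.filter (fun k => k ≠ j),
    (if i = 0 then -(x j 1 - x k 1) else x j 0 - x k 0) / ‖x j - x k‖ ^ 2

/-- The `i`-th component of the anyonic magnetic derivative
`D_jψ = -i∇_{x_j}ψ + A_j ψ`. -/
noncomputable def anyonD (α : ℝ) {n : ℕ} (ψ : (Fin n → EuclideanSpace ℝ (Fin 2)) → ℂ)
    (x : Fin n → EuclideanSpace ℝ (Fin 2)) (j : Fin n) (i : Fin 2) : ℂ :=
  (-Complex.I) * fderiv ℝ ψ x (Pi.single j (EuclideanSpace.single i (1 : ℝ)))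
    + (anyonA α x j i : ℂ) * ψ x

/-- `∫ |ψ|²` over all particle coordinates except the `j`-th one, which is set to `y`. -/
noncomputable def densityAt {N : ℕ} (ψ : (Fin N → EuclideanSpace ℝ (Fin 2)) → ℂ)
    (j : Fin N) (y : EuclideanSpace ℝ (Fin 2)) : ℝ :=
  ∫ z : {k : Fin N // k ≠ j} → EuclideanSpace ℝ (Fin 2),
    ‖ψ (fun k => if h : k = j then y else z ⟨k, h⟩)‖ ^ 2

/-- Fourier coefficients of the derivative of a function with equal end-point values. -/
lemma fourierCoeffOn_deriv_of_eq_endpoints {v v' : ℝ → ℂ} (hv : ∀ x, HasDerivAt v (v' x) x)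
    (hv' : Continuous v') (hper : v Real.pi = v 0) (n : ℤ) :
    fourierCoeffOn Real.pi_pos v' n = 2 * Complex.I * n * fourierCoeffOn Real.pi_pos v n := by
  rcases eq_or_ne n 0 with rfl | hn
  · rw [fourierCoeffOn_eq_integral]
    have h := intervalIntegral.integral_eq_sub_of_hasDerivAt (a := 0) (b := Real.pi)
      (fun x _ => hv x) (hv'.intervalIntegrable _ _)
    simp [h, hper]
  · have h := fourierCoeffOn_of_hasDerivAt Real.pi_pos hn (fun x _ => hv x)
      (hv'.intervalIntegrable _ _)
    have hpi : (Real.pi : ℂ) ≠ 0 := by exact_mod_cast Real.pi_ne_zero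
    have hn' : (n : ℂ) ≠ 0 := by exact_mod_cast hn
    have hI := Complex.I_ne_zero
    rw [h, hper]
    simp only [sub_self, mul_zero, zero_sub, Complex.ofReal_zero, sub_zero]
    field_simp

/-- Poincaré inequality for the operator `-i d/dθ + β` on `π`-periodic functions. -/
lemma periodic_poincare {v v' : ℝ → ℂ} (hv : ∀ x, HasDerivAt v (v' x) x)
    (hv' : Continuous v') (hper : v Real.pi = v 0) {β d : ℝ} (hd : 0 ≤ d)
    (hβ : ∀ n : ℤ, d ≤ |β - 2 * n|) :
    d ^ 2 * ∫ θ in (0 : ℝ)..Real.pi, ‖v θ‖ ^ 2 ≤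
      ∫ θ in (0 : ℝ)..Real.pi, ‖-Complex.I * v' θ + β * v θ‖ ^ 2 := by
  have hvc : Continuous v := continuous_iff_continuousAt.2 fun x => (hv x).continuousAt
  have memL2 : ∀ f : ℝ → ℂ, Continuous f →
      MemLp f 2 (volume.restrict (Set.Ioc 0 Real.pi)) := by
    intro f hf
    obtain ⟨M, hM⟩ := isCompact_Icc.exists_bound_of_continuousOn (s := Set.Icc 0 Real.pi)
      hf.continuousOn
    refine MemLp.of_bound hf.aestronglyMeasurable M ?_
    filter_upwards [ae_restrict_mem measurableSet_Ioc] with x hx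
    exact hM x (Set.Ioc_subset_Icc_self hx)
  have hw : Continuous fun θ => -Complex.I * v' θ + β * v θ := by fun_prop
  have hcoeff : ∀ n : ℤ, fourierCoeffOn Real.pi_pos (fun θ => -Complex.I * v' θ + β * v θ) n
      = (2 * n + β) * fourierCoeffOn Real.pi_pos v n := by
    intro n
    have hadd : fourierCoeffOn Real.pi_pos (fun θ => -Complex.I * v' θ + β * v θ) n
        = -Complex.I * fourierCoeffOn Real.pi_pos v' n + β * fourierCoeffOn Real.pi_pos v n := by
      rw [← fourierCoeffOn.const_mul, ← fourierCoeffOn.const_mul]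
      simp only [fourierCoeffOn_eq_integral]
      rw [← smul_add, ← intervalIntegral.integral_add]
      · simp only [smul_eq_mul, mul_add]
      all_goals
        apply Continuous.intervalIntegrable
        simp only [fourier_coe_apply]
        fun_prop
    rw [hadd, fourierCoeffOn_deriv_of_eq_endpoints hv hv' hper]
    linear_combination (-2 * n * fourierCoeffOn Real.pi_pos v n) * Complex.I_sq
  have h1 := (hasSum_sq_fourierCoeffOn Real.pi_pos (memL2 _ hvc)).mul_left (d ^ 2)
  have h2 := hasSum_sq_fourierCoeffOn Real.pi_pos (memL2 _ hw)
  have hle := hasSum_le (fun n => ?_) h1 h2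
  · simp only [sub_zero, smul_eq_mul] at hle
    have hpi : 0 < Real.pi⁻¹ := inv_pos.2 Real.pi_pos
    rw [mul_left_comm] at hle
    exact le_of_mul_le_mul_left hle hpi
  · rw [hcoeff, norm_mul, mul_pow]
    gcongr
    have := hβ (-n)
    have h3 : ‖(2 * n + β : ℂ)‖ = |β - 2 * ((-n : ℤ) : ℝ)| := by
      rw [← Real.norm_eq_abs, ← Complex.norm_real]; push_cast; ring_nf
    rw [h3]; exact this

/-- Poincaré inequality on `π`-periodic functions for `-i d/dθ + a` with flux `∫ a = π β`. -/
lemma magnetic_periodic_poincare {u u' : ℝ → ℂ} {a : ℝ → ℝ} (hu : ∀ x, HasDerivAt u (u' x) x)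
    (hu' : Continuous u') (ha : Continuous a) (hper : u Real.pi = u 0) {β d : ℝ} (hd : 0 ≤ d)
    (hβ : ∀ n : ℤ, d ≤ |β - 2 * n|) (hflux : ∫ θ in (0 : ℝ)..Real.pi, a θ = Real.pi * β) :
    d ^ 2 * ∫ θ in (0 : ℝ)..Real.pi, ‖u θ‖ ^ 2 ≤
      ∫ θ in (0 : ℝ)..Real.pi, ‖-Complex.I * u' θ + a θ * u θ‖ ^ 2 := by
  set g : ℝ → ℝ := fun θ => (∫ t in (0 : ℝ)..θ, a t) - β * θ with hg
  have hgd : ∀ x, HasDerivAt g (a x - β) x := fun x =>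
    (intervalIntegral.integral_hasDerivAt_right (ha.intervalIntegrable _ _)
      (ha.stronglyMeasurableAtFilter _ _) ha.continuousAt).sub
      (by simpa using (hasDerivAt_id x).const_mul β)
  have hgc : Continuous g := continuous_iff_continuousAt.2 fun x => (hgd x).continuousAt
  have huc : Continuous u := continuous_iff_continuousAt.2 fun x => (hu x).continuousAt
  set E : ℝ → ℂ := fun θ => Complex.exp (g θ * Complex.I) with hE
  have hEd : ∀ x, HasDerivAt E (E x * ((a x - β : ℝ) * Complex.I)) x := fun x =>
    ((hgd x).ofReal_comp.mul_const Complex.I).cexp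
  have hEc : Continuous E := by fun_prop
  have hEn : ∀ x, ‖E x‖ = 1 := fun x => Complex.norm_exp_ofReal_mul_I _
  have key := periodic_poincare (v := fun θ => E θ * u θ)
    (v' := fun θ => E θ * ((a θ - β : ℝ) * Complex.I) * u θ + E θ * u' θ)
    (fun x => (hEd x).mul (hu x)) (by fun_prop) ?_ hd hβ
  · have h1 : ∀ θ, -Complex.I * (E θ * ((a θ - β : ℝ) * Complex.I) * u θ + E θ * u' θ)
        + β * (E θ * u θ) = E θ * (-Complex.I * u' θ + a θ * u θ) := by
      intro θ
      push_cast
      linear_combination (-E θ * u θ * (a θ - β)) * Complex.I_sq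
    simpa only [h1, norm_mul, hEn, one_mul] using key
  · simp only [hE, hg, hflux, hper]
    simp [mul_comm]

/-- The Euclidean plane. -/
abbrev Plane := EuclideanSpace ℝ (Fin 2)

/-- The complex number with the coordinates of a point of the plane. -/
noncomputable def Plane.toComplex (v : Plane) : ℂ := ⟨v 0, v 1⟩

/-- Rotation of the plane by the angle `θ`. -/
noncomputable def planeRot (θ : ℝ) (v : Plane) : Plane :=
  !₂[Real.cos θ * v 0 - Real.sin θ * v 1, Real.sin θ * v 0 + Real.cos θ * v 1]

/-- Counterclockwise rotation of the plane by a right angle. -/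
noncomputable def planePerp (v : Plane) : Plane := !₂[-(v 1), v 0]

@[simp] lemma planeRot_zero_coord (θ : ℝ) (v : Plane) :
    planeRot θ v 0 = Real.cos θ * v 0 - Real.sin θ * v 1 := by simp [planeRot]

@[simp] lemma planeRot_one_coord (θ : ℝ) (v : Plane) :
    planeRot θ v 1 = Real.sin θ * v 0 + Real.cos θ * v 1 := by simp [planeRot]

@[simp] lemma planePerp_zero_coord (v : Plane) : planePerp v 0 = -(v 1) := by simp [planePerp]

@[simp] lemma planePerp_one_coord (v : Plane) : planePerp v 1 = v 0 := by simp [planePerp]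

lemma Plane.norm_sq (v : Plane) : ‖v‖ ^ 2 = v 0 ^ 2 + v 1 ^ 2 := by
  rw [EuclideanSpace.norm_sq_eq]; simp [Fin.sum_univ_two]

lemma Plane.norm_toComplex (v : Plane) : ‖v.toComplex‖ = ‖v‖ := by
  rw [← sq_eq_sq₀ (norm_nonneg _) (norm_nonneg _), Plane.norm_sq, ← Complex.normSq_eq_norm_sq,
    Complex.normSq_apply]
  simp [Plane.toComplex]; ring

lemma norm_planeRot (θ : ℝ) (v : Plane) : ‖planeRot θ v‖ = ‖v‖ := by
  rw [← sq_eq_sq₀ (norm_nonneg _) (norm_nonneg _), Plane.norm_sq, Plane.norm_sq]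
  simp only [planeRot_zero_coord, planeRot_one_coord]
  linear_combination (v 0 ^ 2 + v 1 ^ 2) * Real.sin_sq_add_cos_sq θ

lemma norm_planePerp (v : Plane) : ‖planePerp v‖ = ‖v‖ := by
  rw [← sq_eq_sq₀ (norm_nonneg _) (norm_nonneg _), Plane.norm_sq, Plane.norm_sq]
  simp only [planePerp_zero_coord, planePerp_one_coord]
  ring

lemma Plane.toComplex_add (v w : Plane) : (v + w).toComplex = v.toComplex + w.toComplex := by
  apply Complex.ext <;> simp [Plane.toComplex]

lemma Plane.toComplex_sub (v w : Plane) : (v - w).toComplex = v.toComplex - w.toComplex := by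
  apply Complex.ext <;> simp [Plane.toComplex]

lemma toComplex_planeRot (θ : ℝ) (v : Plane) :
    (planeRot θ v).toComplex = v.toComplex * Complex.exp (θ * Complex.I) := by
  rw [Complex.exp_mul_I, ← Complex.ofReal_cos, ← Complex.ofReal_sin]
  apply Complex.ext <;> simp [Plane.toComplex, -Complex.ofReal_cos, -Complex.ofReal_sin] <;> ring

lemma Plane.re_toComplex_div (w d : Plane) :
    (w.toComplex / d.toComplex).re = (w 0 * d 0 + w 1 * d 1) / ‖d‖ ^ 2 := by
  rw [Complex.div_re, ← Plane.norm_toComplex, ← Complex.normSq_eq_norm_sq]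
  simp only [Plane.toComplex]
  ring

/-- The winding number of a circle around a point off the circle, in real form. -/
lemma integral_re_circle_div {z V : ℂ} (hV : V ≠ 0) (hz : ‖z‖ ≠ ‖V‖) :
    ∫ θ in (0 : ℝ)..2 * Real.pi,
        (V * Complex.exp (θ * Complex.I) / (z + V * Complex.exp (θ * Complex.I))).re
      = if ‖z‖ < ‖V‖ then 2 * Real.pi else 0 := by
  set r := ‖V‖ with hr
  have hr0 : 0 < r := norm_pos_iff.2 hV
  set F : ℝ → ℂ := fun θ => deriv (circleMap 0 r) θ • (circleMap 0 r θ - (-z))⁻¹ with hF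
  have hval : ∫ θ in (0 : ℝ)..2 * Real.pi, F θ
      = if ‖z‖ < r then 2 * Real.pi * Complex.I else 0 := by
    have : ∫ θ in (0 : ℝ)..2 * Real.pi, F θ = ∮ w in C(0, r), (w - (-z))⁻¹ := rfl
    rw [this]
    split_ifs with h
    · exact circleIntegral.integral_sub_inv_of_mem_ball (by simpa using h)
    · refine Complex.circleIntegral_eq_zero_of_differentiable_on_off_countable hr0.le
        Set.countable_empty ?_ ?_
      · intro w hw
        have : w - (-z) ≠ 0 := by
          intro h0
          have hwz : w = -z := sub_eq_zero.1 h0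
          rw [hwz] at hw
          have : ‖z‖ ≤ r := by simpa using hw
          exact hz (le_antisymm this (not_lt.1 h))
        exact ContinuousAt.continuousWithinAt (by fun_prop (disch := assumption))
      · intro w hw
        have : w - (-z) ≠ 0 := by
          intro h0
          have hwz : w = -z := sub_eq_zero.1 h0
          rw [hwz] at hw
          have : ‖z‖ < r := by simpa using hw
          exact h this
        fun_prop (disch := assumption)
  have hper : Function.Periodic F (2 * Real.pi) := by
    intro θ
    simp only [hF, deriv_circleMap, periodic_circleMap 0 r θ]
  have hshift : ∫ θ in (0 : ℝ)..2 * Real.pi, F (θ + V.arg) = ∫ θ in (0 : ℝ)..2 * Real.pi, F θ := by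
    rw [intervalIntegral.integral_comp_add_right]
    have := hper.intervalIntegral_add_eq V.arg 0
    rw [zero_add] at this
    rw [← this, zero_add, add_comm]
  have hne : ∀ θ, circleMap 0 r θ - (-z) ≠ 0 := by
    intro θ h0
    apply hz
    have : z = -circleMap 0 r θ := by linear_combination h0
    rw [this, norm_neg]
    simp [abs_of_pos hr0]
  have hFc : Continuous F := by
    simp only [hF, deriv_circleMap, smul_eq_mul]
    exact (by fun_prop : Continuous fun θ => circleMap 0 r θ * Complex.I).mul
      (Continuous.inv₀ (by fun_prop) hne)
  have hpt : ∀ θ : ℝ, (V * Complex.exp (θ * Complex.I) / (z + V * Complex.exp (θ * Complex.I))).re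
      = Complex.imCLM (F (θ + V.arg)) := by
    intro θ
    have h1 : circleMap 0 r (θ + V.arg) = V * Complex.exp (θ * Complex.I) := by
      rw [circleMap, zero_add, Complex.ofReal_add, add_mul, Complex.exp_add]
      linear_combination Complex.exp (θ * Complex.I) * Complex.norm_mul_exp_arg_mul_I V
    simp only [hF, deriv_circleMap, smul_eq_mul, Complex.imCLM_apply, h1]
    rw [show V * Complex.exp (θ * Complex.I) * Complex.I * (V * Complex.exp (θ * Complex.I) - -z)⁻¹
      = (V * Complex.exp (θ * Complex.I) / (z + V * Complex.exp (θ * Complex.I))) * Complex.I by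
        rw [sub_neg_eq_add, add_comm z]; ring]
    simp
  simp only [hpt]
  rw [Complex.imCLM.intervalIntegral_comp_comm
    ((by fun_prop : Continuous fun θ => F (θ + V.arg)).intervalIntegrable _ _), hshift, hval]
  split_ifs <;> simp

lemma sum_planePerp_mul_anyonA (α : ℝ) {n : ℕ} (y : Fin n → Plane) (j : Fin n) (w : Plane) :
    ∑ i, planePerp w i * anyonA α y j i
      = α * ∑ l ∈ Finset.univ.filter (fun l => l ≠ j),
          (w.toComplex / (y j - y l).toComplex).re := by
  simp only [Fin.sum_univ_two, anyonA, planePerp_zero_coord, planePerp_one_coord,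
    Plane.re_toComplex_div, Finset.mul_sum, ← Finset.sum_add_distrib]
  refine Finset.sum_congr rfl fun l _ => ?_
  simp
  ring

/-- The configuration `x` with particles `j` and `k` moved to `X + w` and `X - w`. -/
def pairPos {n : ℕ} (j k : Fin n) (x : Fin n → Plane) (X w : Plane) : Fin n → Plane :=
  fun l => if l = j then X + w else if l = k then X - w else x l

section pairPos

variable {n : ℕ} {j k : Fin n} (x : Fin n → Plane) (X w : Plane)

lemma pairPos_left : pairPos j k x X w j = X + w := by simp [pairPos]

lemma pairPos_right (hjk : j ≠ k) : pairPos j k x X w k = X - w := by simp [pairPos, hjk.symm]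

lemma pairPos_other {l : Fin n} (hj : l ≠ j) (hk : l ≠ k) : pairPos j k x X w l = x l := by
  simp [pairPos, hj, hk]

end pairPos

lemma filter_ne_eq_insert {n : ℕ} {j k : Fin n} (hjk : j ≠ k) :
    Finset.univ.filter (fun l => l ≠ j)
      = insert k (Finset.univ.filter (fun l => l ≠ j ∧ l ≠ k)) := by
  ext l
  simp only [Finset.mem_filter, Finset.mem_univ, true_and, Finset.mem_insert]
  constructor
  · intro h
    by_cases h2 : l = k
    · exact Or.inl h2
    · exact Or.inr ⟨h, h2⟩
  · rintro (h | h)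
    · rw [h]; exact hjk.symm
    · exact h.1

/-- The magnetic potential along a joint rotation of particles `j` and `k`. -/
lemma sum_planePerp_mul_anyonA_sub (α : ℝ) {n : ℕ} {j k : Fin n} (hjk : j ≠ k)
    (x : Fin n → Plane) (X : Plane) {w : Plane} (hw : w ≠ 0) :
    ∑ i, planePerp w i * (anyonA α (pairPos j k x X w) j i - anyonA α (pairPos j k x X w) k i)
      = α * (1 + ∑ l ∈ Finset.univ.filter (fun l => l ≠ j ∧ l ≠ k),
          ((w.toComplex / ((X - x l).toComplex + w.toComplex)).re
            + (-w.toComplex / ((X - x l).toComplex + -w.toComplex)).re)) := by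
  have hwc : w.toComplex ≠ 0 := by
    rw [← norm_pos_iff, Plane.norm_toComplex]; exact norm_pos_iff.2 hw
  simp only [mul_sub, Finset.sum_sub_distrib, sum_planePerp_mul_anyonA]
  rw [filter_ne_eq_insert hjk, filter_ne_eq_insert hjk.symm, Finset.sum_insert (by simp),
    Finset.sum_insert (by simp), Finset.sum_add_distrib]
  have e1 : (w.toComplex / (pairPos j k x X w j - pairPos j k x X w k).toComplex).re = 1 / 2 := by
    rw [pairPos_left, pairPos_right _ _ _ hjk,
      show X + w - (X - w) = w + w by abel, Plane.toComplex_add, ← two_mul,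
      div_mul_cancel_right₀ hwc]
    norm_num
  have e2 : (w.toComplex / (pairPos j k x X w k - pairPos j k x X w j).toComplex).re
      = -(1 / 2) := by
    rw [pairPos_left, pairPos_right _ _ _ hjk,
      show X - w - (X + w) = 0 - (w + w) by abel, Plane.toComplex_sub, Plane.toComplex_add,
      show Plane.toComplex 0 = 0 from Complex.ext (by simp [Plane.toComplex])
        (by simp [Plane.toComplex]), zero_sub, ← two_mul, div_neg,
      div_mul_cancel_right₀ hwc]
    norm_num
  have e3 : ∑ l ∈ Finset.univ.filter (fun l => l ≠ j ∧ l ≠ k),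
        (w.toComplex / (pairPos j k x X w j - pairPos j k x X w l).toComplex).re
      = ∑ l ∈ Finset.univ.filter (fun l => l ≠ j ∧ l ≠ k),
        (w.toComplex / ((X - x l).toComplex + w.toComplex)).re := by
    refine Finset.sum_congr rfl fun l hl => ?_
    simp only [Finset.mem_filter, Finset.mem_univ, true_and] at hl
    rw [pairPos_left, pairPos_other _ _ _ hl.1 hl.2, ← Plane.toComplex_add,
      show X + w - x l = X - x l + w by abel]
  have e4 : ∑ l ∈ Finset.univ.filter (fun l => l ≠ k ∧ l ≠ j),
        (w.toComplex / (pairPos j k x X w k - pairPos j k x X w l).toComplex).re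
      = -∑ l ∈ Finset.univ.filter (fun l => l ≠ j ∧ l ≠ k),
        (-w.toComplex / ((X - x l).toComplex + -w.toComplex)).re := by
    rw [← Finset.sum_neg_distrib]
    refine Finset.sum_congr (by ext l; simp [and_comm]) fun l hl => ?_
    simp only [Finset.mem_filter, Finset.mem_univ, true_and] at hl
    rw [pairPos_right _ _ _ hjk, pairPos_other _ _ _ hl.1 hl.2, ← sub_eq_add_neg,
      ← Plane.toComplex_sub, show X - w - x l = X - x l - w by abel, neg_div, Complex.neg_re,
      neg_neg]
  rw [e1, e2, e3, e4]
  ring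

/-- The potential along a joint rotation is continuous in the angle, and its flux over a
half-turn is an odd multiple of `π α`, if no other particle is on the circle. -/
lemma pair_flux (α : ℝ) {n : ℕ} {j k : Fin n} (hjk : j ≠ k)
    (x : Fin n → Plane) (X : Plane) {v : Plane} (hv : v ≠ 0)
    (hx : ∀ l, l ≠ j → l ≠ k → ‖X - x l‖ ≠ ‖v‖) :
    Continuous (fun θ : ℝ => ∑ i, planePerp (planeRot θ v) i *
      (anyonA α (pairPos j k x X (planeRot θ v)) j i
        - anyonA α (pairPos j k x X (planeRot θ v)) k i)) ∧
    ∃ p : ℕ, p ≤ n - 2 ∧ ∫ θ in (0 : ℝ)..Real.pi, ∑ i, planePerp (planeRot θ v) i *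
      (anyonA α (pairPos j k x X (planeRot θ v)) j i
        - anyonA α (pairPos j k x X (planeRot θ v)) k i)
      = Real.pi * ((2 * p + 1) * α) := by
  set V := v.toComplex with hVdef
  have hV : V ≠ 0 := by
    rw [← norm_pos_iff, Plane.norm_toComplex]; exact norm_pos_iff.2 hv
  have hrot : ∀ θ, planeRot θ v ≠ 0 := fun θ => by
    rw [← norm_pos_iff, norm_planeRot]; exact norm_pos_iff.2 hv
  set S := Finset.univ.filter (fun l : Fin n => l ≠ j ∧ l ≠ k) with hS
  set z : Fin n → ℂ := fun l => (X - x l).toComplex with hz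
  set g : Fin n → ℝ → ℝ := fun l θ =>
    (V * Complex.exp (θ * Complex.I) / (z l + V * Complex.exp (θ * Complex.I))).re with hg
  have hzV : ∀ l ∈ S, ‖z l‖ ≠ ‖V‖ := by
    intro l hl
    simp only [hS, Finset.mem_filter, Finset.mem_univ, true_and] at hl
    simpa only [hz, hVdef, Plane.norm_toComplex] using hx l hl.1 hl.2
  have hgc : ∀ l ∈ S, Continuous (g l) := by
    intro l hl
    refine Complex.continuous_re.comp (Continuous.div (by fun_prop) (by fun_prop) fun θ h0 => ?_)
    apply hzV l hl
    rw [eq_neg_of_add_eq_zero_left h0, norm_neg, norm_mul, Complex.norm_exp_ofReal_mul_I, mul_one]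
  have hexp : ∀ θ : ℝ, Complex.exp ((θ + Real.pi : ℝ) * Complex.I)
      = -Complex.exp (θ * Complex.I) := by
    intro θ
    rw [Complex.ofReal_add, add_mul, Complex.exp_add, Complex.exp_pi_mul_I]; ring
  have hfun : (fun θ : ℝ => ∑ i, planePerp (planeRot θ v) i *
      (anyonA α (pairPos j k x X (planeRot θ v)) j i
        - anyonA α (pairPos j k x X (planeRot θ v)) k i))
      = fun θ => α * (1 + ∑ l ∈ S, (g l θ + g l (θ + Real.pi))) := by
    funext θ
    rw [sum_planePerp_mul_anyonA_sub α hjk x X (hrot θ), toComplex_planeRot]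
    simp only [hg, hexp, mul_neg, hz, hVdef, hS]
  have hgc2 : ∀ l ∈ S, Continuous fun θ => g l θ + g l (θ + Real.pi) := fun l hl =>
    (hgc l hl).add ((hgc l hl).comp (by fun_prop))
  refine ⟨?_, (S.filter fun l => ‖z l‖ < ‖V‖).card, ?_, ?_⟩
  · rw [hfun]
    exact continuous_const.mul (continuous_const.add (continuous_finsetSum _ hgc2))
  · refine (Finset.card_filter_le _ _).trans ?_
    have h1 : S = Finset.univ \ {j, k} := by
      ext l; simp [hS]
    rw [h1, Finset.card_sdiff_of_subset (Finset.subset_univ _), Finset.card_univ,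
      Fintype.card_fin, Finset.card_pair hjk]
  · rw [hfun, intervalIntegral.integral_const_mul, intervalIntegral.integral_add
      intervalIntegrable_const
      ((continuous_finsetSum _ hgc2).intervalIntegrable _ _),
      intervalIntegral.integral_finsetSum fun l hl => (hgc2 l hl).intervalIntegrable _ _]
    have h1 : ∀ l ∈ S, ∫ θ in (0 : ℝ)..Real.pi, (g l θ + g l (θ + Real.pi))
        = if ‖z l‖ < ‖V‖ then 2 * Real.pi else 0 := by
      intro l hl
      have hc := hgc l hl
      have hcs : Continuous fun θ => g l (θ + Real.pi) := by fun_prop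
      rw [← integral_re_circle_div hV (hzV l hl), intervalIntegral.integral_add
        (hc.intervalIntegrable _ _) (hcs.intervalIntegrable _ _), intervalIntegral.integral_comp_add_right, zero_add, ← two_mul]
      exact intervalIntegral.integral_add_adjacent_intervals
        ((hgc l hl).intervalIntegrable _ _) ((hgc l hl).intervalIntegrable _ _)
    rw [Finset.sum_congr rfl h1, ← Finset.sum_filter, Finset.sum_const, nsmul_eq_mul]
    simp
    ring

/-- The kinetic energy density of the `j`-th particle. -/
noncomputable def anyonEnergy (α : ℝ) {n : ℕ} (ψ : (Fin n → Plane) → ℂ) (j : Fin n)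
    (x : Fin n → Plane) : ℝ :=
  ∑ i : Fin 2, ‖anyonD α ψ x j i‖ ^ 2

lemma anyonEnergy_nonneg (α : ℝ) {n : ℕ} (ψ : (Fin n → Plane) → ℂ) (j : Fin n)
    (x : Fin n → Plane) : 0 ≤ anyonEnergy α ψ j x := by
  unfold anyonEnergy; positivity

section Regularity

variable {α : ℝ} {n : ℕ} {ψ : (Fin n → Plane) → ℂ}

lemma anyonD_eq_zero_of_notMem {x : Fin n → Plane} (hx : x ∉ tsupport ψ) (j : Fin n)
    (i : Fin 2) : anyonD α ψ x j i = 0 := by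
  have h1 : ψ x = 0 := image_eq_zero_of_notMem_tsupport hx
  have h2 : fderiv ℝ ψ x = 0 := by
    by_contra h
    exact hx (support_fderiv_subset ℝ h)
  simp [anyonD, h1, h2]

lemma continuous_anyonD (hψ : ContDiff ℝ (⊤ : ℕ∞) ψ)
    (hsupp : ∀ x ∈ tsupport ψ, ∀ j k : Fin n, j ≠ k → x j ≠ x k) (j : Fin n) (i : Fin 2) :
    Continuous fun x => anyonD α ψ x j i := by
  rw [continuous_iff_continuousAt]
  intro x
  by_cases hx : x ∈ tsupport ψ
  · have hd : Continuous fun x => fderiv ℝ ψ x (Pi.single j (EuclideanSpace.single i (1 : ℝ))) :=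
      (hψ.continuous_fderiv (by simp)).clm_apply continuous_const
    have hA : ContinuousAt (fun x => anyonA α x j i) x := by
      unfold anyonA
      refine continuousAt_const.mul (tendsto_finsetSum _ fun k hk => ?_)
      simp only [Finset.mem_filter, Finset.mem_univ, true_and] at hk
      refine ContinuousAt.div ?_ (by fun_prop) ?_
      · split_ifs <;> fun_prop
      · have := sub_ne_zero.2 (hsupp x hx j k hk.symm)
        positivity
    unfold anyonD
    exact (continuousAt_const.mul hd.continuousAt).add
      ((Complex.continuous_ofReal.continuousAt.comp hA).mul hψ.continuous.continuousAt)
  · have h : (fun x => anyonD α ψ x j i) =ᶠ[nhds x] fun _ => 0 := by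
      filter_upwards [(isClosed_tsupport ψ).isOpen_compl.mem_nhds hx] with y hy
      exact anyonD_eq_zero_of_notMem hy j i
    exact continuousAt_const.congr h.symm

lemma continuous_anyonEnergy (hψ : ContDiff ℝ (⊤ : ℕ∞) ψ)
    (hsupp : ∀ x ∈ tsupport ψ, ∀ j k : Fin n, j ≠ k → x j ≠ x k) (j : Fin n) :
    Continuous (anyonEnergy α ψ j) := by
  unfold anyonEnergy
  exact continuous_finsetSum _ fun i _ => (continuous_anyonD hψ hsupp j i).norm.pow 2

lemma hasCompactSupport_anyonEnergy (hcs : HasCompactSupport ψ) (j : Fin n) :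
    HasCompactSupport (anyonEnergy α ψ j) :=
  HasCompactSupport.intro hcs fun x hx => by
    simp [anyonEnergy, anyonD_eq_zero_of_notMem hx]

lemma eq_zero_of_coincide (hsupp : ∀ x ∈ tsupport ψ, ∀ j k : Fin n, j ≠ k → x j ≠ x k)
    {x : Fin n → Plane} {j k : Fin n} (hjk : j ≠ k) (hx : x j = x k) : ψ x = 0 :=
  image_eq_zero_of_notMem_tsupport fun h => hsupp x h j k hjk hx

lemma fderiv_pair_eq {x : Fin n → Plane} (j : Fin n) (a : Plane) :
    fderiv ℝ ψ x (Pi.single j a)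
      = ∑ i, (a i : ℂ) * fderiv ℝ ψ x (Pi.single j (EuclideanSpace.single i (1 : ℝ))) := by
  have h : (Pi.single j a : Fin n → Plane)
      = ∑ i, a i • Pi.single j (EuclideanSpace.single i (1 : ℝ)) := by
    simp_rw [← Pi.single_smul]
    rw [Fin.sum_univ_two, ← Pi.single_add]
    congr 1
    ext i; fin_cases i <;> simp
  rw [h, map_sum]
  simp only [map_smul, Complex.real_smul]

/-- The derivative in direction of a one-particle displacement in terms of the magnetic one. -/
lemma neg_I_mul_fderiv_single (x : Fin n → Plane) (j : Fin n) (a : Plane) :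
    -Complex.I * fderiv ℝ ψ x (Pi.single j a) + ((∑ i, a i * anyonA α x j i : ℝ) : ℂ) * ψ x
      = ∑ i, (a i : ℂ) * anyonD α ψ x j i := by
  rw [fderiv_pair_eq]
  simp only [anyonD, Fin.sum_univ_two]
  push_cast
  ring

lemma norm_sum_mul_anyonD_sq_le (x : Fin n → Plane) (j : Fin n) (a : Plane) :
    ‖∑ i, (a i : ℂ) * anyonD α ψ x j i‖ ^ 2 ≤ ‖a‖ ^ 2 * anyonEnergy α ψ j x := by
  calc ‖∑ i, (a i : ℂ) * anyonD α ψ x j i‖ ^ 2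
      ≤ (∑ i, |a i| * ‖anyonD α ψ x j i‖) ^ 2 := by
        gcongr
        refine (norm_sum_le _ _).trans (le_of_eq (Finset.sum_congr rfl fun i _ => ?_))
        rw [norm_mul, Complex.norm_real, Real.norm_eq_abs]
    _ ≤ (∑ i, |a i| ^ 2) * ∑ i, ‖anyonD α ψ x j i‖ ^ 2 := Finset.sum_mul_sq_le_sq_mul_sq _ _ _
    _ = ‖a‖ ^ 2 * anyonEnergy α ψ j x := by
        rw [EuclideanSpace.norm_sq_eq]; simp [anyonEnergy]

/-- Cauchy–Schwarz for the magnetic derivative along a displacement of two particles. -/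
lemma norm_pair_derivative_sq_le (x : Fin n → Plane) (j k : Fin n) (a b : Plane) :
    ‖(∑ i, (a i : ℂ) * anyonD α ψ x j i) + ∑ i, (b i : ℂ) * anyonD α ψ x k i‖ ^ 2
      ≤ (‖a‖ ^ 2 + ‖b‖ ^ 2) * (anyonEnergy α ψ j x + anyonEnergy α ψ k x) := by
  have h1 := norm_sum_mul_anyonD_sq_le (α := α) (ψ := ψ) x j a
  have h2 := norm_sum_mul_anyonD_sq_le (α := α) (ψ := ψ) x k b
  set p := ∑ i, (a i : ℂ) * anyonD α ψ x j i
  set q := ∑ i, (b i : ℂ) * anyonD α ψ x k i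
  have hA := anyonEnergy_nonneg α ψ j x
  have hB := anyonEnergy_nonneg α ψ k x
  set A := anyonEnergy α ψ j x
  set B := anyonEnergy α ψ k x
  have h3 : ‖p‖ * ‖q‖ * 2 ≤ ‖a‖ ^ 2 * B + ‖b‖ ^ 2 * A := by
    have h4 : ‖p‖ ≤ ‖a‖ * √A := by
      rw [← sq_le_sq₀ (norm_nonneg _) (by positivity), mul_pow, Real.sq_sqrt hA]; exact h1
    have h5 : ‖q‖ ≤ ‖b‖ * √B := by
      rw [← sq_le_sq₀ (norm_nonneg _) (by positivity), mul_pow, Real.sq_sqrt hB]; exact h2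
    have h6 : ‖p‖ * ‖q‖ ≤ (‖a‖ * √A) * (‖b‖ * √B) := by gcongr
    nlinarith [sq_nonneg (‖a‖ * √B - ‖b‖ * √A), Real.sq_sqrt hA, Real.sq_sqrt hB]
  have h7 : ‖p + q‖ ^ 2 ≤ (‖p‖ + ‖q‖) ^ 2 := by gcongr; exact norm_add_le _ _
  nlinarith

/-- The derivative of `|ψ|²` only sees the magnetic derivative. -/
lemma abs_inner_fderiv_le (x h : Fin n → Plane) (D : ℂ) (r : ℝ)
    (hD : -Complex.I * fderiv ℝ ψ x h + r * ψ x = D) :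
    |2 * inner ℝ (ψ x) (fderiv ℝ ψ x h)| ≤ 2 * (‖ψ x‖ * ‖D‖) := by
  have h1 : fderiv ℝ ψ x h = Complex.I * D - r * (Complex.I * ψ x) := by
    rw [← hD]; linear_combination (fderiv ℝ ψ x h) * Complex.I_sq
  have h2 : inner ℝ (ψ x) (fderiv ℝ ψ x h) = inner ℝ (ψ x) (Complex.I * D) := by
    rw [h1, inner_sub_right]
    simp only [Complex.inner, sub_eq_self]
    simp
    ring
  rw [h2, abs_mul, abs_two]
  gcongr
  refine (abs_real_inner_le_norm _ _).trans (by simp)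

end Regularity

lemma Calpha_nonneg (α : ℝ) (n : ℕ) : 0 ≤ Calpha α n := by
  refine Real.sInf_nonneg ?_
  rintro c ⟨p, q, -, rfl⟩
  exact abs_nonneg _

lemma Calpha_le (α : ℝ) {n p : ℕ} (hp : p ≤ n - 2) (q : ℤ) :
    Calpha α n ≤ |(2 * (p : ℝ) + 1) * α - 2 * (q : ℝ)| := by
  refine csInf_le ⟨0, ?_⟩ ⟨p, q, hp, rfl⟩
  rintro c ⟨p, q, -, rfl⟩
  exact abs_nonneg _

lemma Calpha_le_one (α : ℝ) (n : ℕ) : Calpha α n ≤ 1 := by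
  refine (Calpha_le α (Nat.zero_le _) (round (α / 2))).trans ?_
  have := abs_sub_round (α / 2)
  rw [abs_le] at this ⊢
  constructor <;> push_cast <;> linarith

lemma hasDerivAt_planeRot (v : Plane) (θ : ℝ) :
    HasDerivAt (fun θ => planeRot θ v) (planePerp (planeRot θ v)) θ := by
  have h : ∀ θ, planeRot θ v = Real.cos θ • v + Real.sin θ • planePerp v := fun θ => by
    ext i; fin_cases i <;> simp [sub_eq_add_neg, add_comm]
  have h1 := ((Real.hasDerivAt_cos θ).smul_const v).add
    ((Real.hasDerivAt_sin θ).smul_const (planePerp v))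
  have h2 : planePerp (planeRot θ v) = -Real.sin θ • v + Real.cos θ • planePerp v := by
    ext i; fin_cases i <;> simp <;> ring
  rw [h2, funext h]
  exact h1

lemma planeRot_pi (v : Plane) : planeRot Real.pi v = -v := by
  ext i; fin_cases i <;> simp

lemma planeRot_zero (v : Plane) : planeRot 0 v = v := by
  ext i; fin_cases i <;> simp

lemma Continuous.planeRot {Y : Type*} [TopologicalSpace Y] {f : Y → ℝ} {g : Y → Plane}
    (hf : Continuous f) (hg : Continuous g) : Continuous fun y => planeRot (f y) (g y) := by
  unfold _root_.planeRot
  fun_prop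

lemma continuous_planePerp : Continuous planePerp := by
  unfold planePerp
  fun_prop

lemma continuous_pairPos {n : ℕ} (j k : Fin n) :
    Continuous fun p : (Fin n → Plane) × Plane × Plane => pairPos j k p.1 p.2.1 p.2.2 := by
  refine continuous_pi fun l => ?_
  simp only [pairPos]
  split_ifs <;> fun_prop

lemma pairPos_swap {n : ℕ} {j k : Fin n} (x : Fin n → Plane) (X w : Plane) (hjk : j ≠ k) :
    pairPos j k x X (-w) = pairPos j k x X w ∘ Equiv.swap j k := by
  funext l
  rcases eq_or_ne l j with rfl | hj
  · simp [pairPos, hjk.symm, sub_eq_add_neg]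
  rcases eq_or_ne l k with rfl | hk
  · simp [pairPos, hj]
  · simp [pairPos, hj, hk, Equiv.swap_apply_of_ne_of_ne hj hk]

lemma hasDerivAt_pairPos_planeRot {n : ℕ} {j k : Fin n} (hjk : j ≠ k) (x : Fin n → Plane)
    (X v : Plane) (θ : ℝ) :
    HasDerivAt (fun θ => pairPos j k x X (planeRot θ v))
      (Pi.single j (planePerp (planeRot θ v)) + Pi.single k (-planePerp (planeRot θ v))) θ := by
  rw [hasDerivAt_pi]
  intro l
  have h := hasDerivAt_planeRot v θ
  rcases eq_or_ne l j with rfl | hj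
  · simpa [pairPos, hjk] using h
  rcases eq_or_ne l k with rfl | hk
  · simpa [pairPos, hj] using h.const_sub X
  · simpa [pairPos, hj, hk] using hasDerivAt_const θ (x l)

section Circle

variable {α : ℝ} {n : ℕ} {ψ : (Fin n → Plane) → ℂ}

/-- Poincaré inequality on the circle of relative positions of two particles, when no other
particle lies on that circle. -/
lemma circle_poincare_of_ne (hψ : ContDiff ℝ (⊤ : ℕ∞) ψ)
    (hsym : ∀ (σ : Equiv.Perm (Fin n)) (x : Fin n → Plane), ψ (x ∘ σ) = ψ x)
    (hsupp : ∀ x ∈ tsupport ψ, ∀ j k : Fin n, j ≠ k → x j ≠ x k)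
    {j k : Fin n} (hjk : j ≠ k) (x : Fin n → Plane) (X : Plane) {v : Plane} (hv : v ≠ 0)
    (hx : ∀ l, l ≠ j → l ≠ k → ‖X - x l‖ ≠ ‖v‖) :
    Calpha α n ^ 2 * ∫ θ in (0 : ℝ)..Real.pi, ‖ψ (pairPos j k x X (planeRot θ v))‖ ^ 2
      ≤ ∫ θ in (0 : ℝ)..Real.pi, 2 * ‖v‖ ^ 2 *
          (anyonEnergy α ψ j (pairPos j k x X (planeRot θ v))
            + anyonEnergy α ψ k (pairPos j k x X (planeRot θ v))) := by
  obtain ⟨hac, p, hp, hflux⟩ := pair_flux α hjk x X hv hx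
  have hd : ∀ y, HasFDerivAt ψ (fderiv ℝ ψ y) y := fun y =>
    ((hψ.differentiable (by simp)) y).hasFDerivAt
  obtain ⟨γ, hγ⟩ : ∃ γ : ℝ → Fin n → Plane, ∀ θ, pairPos j k x X (planeRot θ v) = γ θ :=
    ⟨_, fun _ => rfl⟩
  have hγd := hasDerivAt_pairPos_planeRot hjk x X v
  simp only [hγ] at hac hflux hγd ⊢
  obtain ⟨w, hw⟩ : ∃ w : ℝ → Fin n → Plane, ∀ θ, w θ =
    Pi.single j (planePerp (planeRot θ v)) + Pi.single k (-planePerp (planeRot θ v)) :=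
    ⟨_, fun _ => rfl⟩
  have hrotc : Continuous fun θ => planeRot θ v :=
    continuous_iff_continuousAt.2 fun θ => (hasDerivAt_planeRot v θ).continuousAt
  have hγc : Continuous γ := by
    rw [← funext hγ]
    exact
    (continuous_pairPos j k).comp (continuous_const.prodMk (continuous_const.prodMk hrotc))
  have hpc : Continuous fun θ => planePerp (planeRot θ v) := continuous_planePerp.comp hrotc
  have hwc : Continuous w := by
    rw [funext hw]
    exact ((continuous_single (A := fun _ => Plane) j).comp hpc).add
      ((continuous_single (A := fun _ => Plane) k).comp hpc.neg)
  have hu : ∀ θ, HasDerivAt (fun θ => ψ (γ θ)) (fderiv ℝ ψ (γ θ) (w θ)) θ := fun θ =>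
    (hd (γ θ)).comp_hasDerivAt θ (hw θ ▸ hγd θ)
  have hu' : Continuous fun θ => fderiv ℝ ψ (γ θ) (w θ) :=
    ((hψ.continuous_fderiv (by simp)).comp hγc).clm_apply hwc
  have hper : ψ (γ Real.pi) = ψ (γ 0) := by
    simp only [← hγ, planeRot_pi, planeRot_zero, pairPos_swap x X v hjk, hsym]
  have key := magnetic_periodic_poincare hu hu' hac hper
    (Calpha_nonneg α n) (fun q => Calpha_le α hp q) hflux
  refine key.trans ?_
  have hE : ∀ i, Continuous fun θ => anyonEnergy α ψ i (γ θ) := fun i =>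
    (continuous_anyonEnergy hψ hsupp i).comp hγc
  refine intervalIntegral.integral_mono_on Real.pi_pos.le ?_ ?_ fun θ _ => ?_
  · have hc := (continuous_const (y := -Complex.I).mul hu').add
      ((Complex.continuous_ofReal.comp hac).mul (hψ.continuous.comp hγc))
    exact (hc.norm.pow 2).intervalIntegrable _ _
  · exact (continuous_const.mul ((hE j).add (hE k))).intervalIntegrable _ _
  · have h := norm_pair_derivative_sq_le (α := α) (ψ := ψ) (γ θ) j k
      (planePerp (planeRot θ v)) (-planePerp (planeRot θ v))
    rw [norm_neg, norm_planePerp, norm_planeRot, ← two_mul] at h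
    refine le_of_eq_of_le ?_ h
    rw [← neg_I_mul_fderiv_single, ← neg_I_mul_fderiv_single, hw, map_add]
    congr 2
    simp only [Fin.sum_univ_two, PiLp.neg_apply]
    push_cast
    ring

end Circle

section Circle

variable {α : ℝ} {n : ℕ} {ψ : (Fin n → Plane) → ℂ}

/-- Poincaré inequality on the circle of relative positions of two particles. -/
lemma circle_poincare (hψ : ContDiff ℝ (⊤ : ℕ∞) ψ)
    (hsym : ∀ (σ : Equiv.Perm (Fin n)) (x : Fin n → Plane), ψ (x ∘ σ) = ψ x)
    (hsupp : ∀ x ∈ tsupport ψ, ∀ j k : Fin n, j ≠ k → x j ≠ x k)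
    {j k : Fin n} (hjk : j ≠ k) (x : Fin n → Plane) (X v : Plane) :
    Calpha α n ^ 2 * ∫ θ in (0 : ℝ)..Real.pi, ‖ψ (pairPos j k x X (planeRot θ v))‖ ^ 2
      ≤ ∫ θ in (0 : ℝ)..Real.pi, 2 * ‖v‖ ^ 2 *
          (anyonEnergy α ψ j (pairPos j k x X (planeRot θ v))
            + anyonEnergy α ψ k (pairPos j k x X (planeRot θ v))) := by
  rcases eq_or_ne v 0 with rfl | hv
  · have h0 : ∀ θ, ψ (pairPos j k x X (planeRot θ 0)) = 0 := fun θ => by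
      refine eq_zero_of_coincide hsupp hjk ?_
      have : planeRot θ 0 = 0 := by rw [← norm_eq_zero, norm_planeRot, norm_zero]
      rw [pairPos_left, pairPos_right _ _ _ hjk, this, add_zero, sub_zero]
    simp [h0]
  obtain ⟨ξ, hξ⟩ : ∃ ξ : ℝ → Fin n → Plane, ∀ ε l, ξ ε l = x l + ε • (x l - X) :=
    ⟨_, fun _ _ => rfl⟩
  have hξc : Continuous ξ := continuous_pi fun l => by simp only [hξ]; fun_prop
  have hξ0 : ξ 0 = x := by funext l; simp [hξ]
  obtain ⟨γ, hγ⟩ : ∃ γ : ℝ → ℝ → Fin n → Plane,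
      ∀ ε θ, pairPos j k (ξ ε) X (planeRot θ v) = γ ε θ := ⟨_, fun _ _ => rfl⟩
  have hrotc : Continuous fun θ => planeRot θ v :=
    continuous_iff_continuousAt.2 fun θ => (hasDerivAt_planeRot v θ).continuousAt
  have hγc : Continuous fun p : ℝ × ℝ => γ p.1 p.2 := by
    simp only [← hγ]
    exact (continuous_pairPos j k).comp ((hξc.comp continuous_fst).prodMk
      (continuous_const.prodMk (hrotc.comp continuous_snd)))
  have hgood : ∀ᶠ ε in nhdsWithin (0 : ℝ) {0}ᶜ, ∀ l : Fin n, ‖X - ξ ε l‖ ≠ ‖v‖ := by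
    rw [Filter.eventually_all]
    intro l
    have hl : ∀ ε, ‖X - ξ ε l‖ = |1 + ε| * ‖X - x l‖ := fun ε => by
      rw [← Real.norm_eq_abs, ← norm_smul, hξ]; congr 1; module
    rcases eq_or_ne ‖X - x l‖ ‖v‖ with h | h
    · filter_upwards [self_mem_nhdsWithin,
        nhdsWithin_le_nhds (Ioi_mem_nhds (show (-1 : ℝ) < 0 by norm_num))] with ε hε hε1
      rw [hl, h]
      have hv' := norm_pos_iff.2 hv
      rw [abs_of_pos (by linarith [Set.mem_Ioi.1 hε1])]
      intro h'
      exact hε (by nlinarith : ε = 0)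
    · refine nhdsWithin_le_nhds (ContinuousAt.eventually_ne ?_ ?_)
      · have : Continuous fun ε => ξ ε l := (continuous_apply l).comp hξc
        exact (continuous_const.sub this).norm.continuousAt
      · rwa [hξ0]
  have hineq : ∀ᶠ ε in nhdsWithin (0 : ℝ) {0}ᶜ,
      Calpha α n ^ 2 * ∫ θ in (0 : ℝ)..Real.pi, ‖ψ (γ ε θ)‖ ^ 2
      ≤ ∫ θ in (0 : ℝ)..Real.pi, 2 * ‖v‖ ^ 2 *
          (anyonEnergy α ψ j (γ ε θ) + anyonEnergy α ψ k (γ ε θ)) := by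
    filter_upwards [hgood] with ε hε
    have := circle_poincare_of_ne (α := α) hψ hsym hsupp hjk (ξ ε) X hv fun l _ _ => hε l
    simpa only [hγ] using this
  have hE : ∀ i, Continuous fun p : ℝ × ℝ => anyonEnergy α ψ i (γ p.1 p.2) := fun i =>
    (continuous_anyonEnergy hψ hsupp i).comp hγc
  have hψc : Continuous fun p : ℝ × ℝ => ‖ψ (γ p.1 p.2)‖ ^ 2 :=
    ((hψ.continuous.comp hγc).norm).pow 2
  have hEc : Continuous fun p : ℝ × ℝ => 2 * ‖v‖ ^ 2 *
      (anyonEnergy α ψ j (γ p.1 p.2) + anyonEnergy α ψ k (γ p.1 p.2)) :=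
    continuous_const.mul ((hE j).add (hE k))
  have h1 := intervalIntegral.continuous_parametric_intervalIntegral_of_continuous' (μ := volume)
    (f := fun ε θ => ‖ψ (γ ε θ)‖ ^ 2) hψc 0 Real.pi
  have h2 := intervalIntegral.continuous_parametric_intervalIntegral_of_continuous' (μ := volume)
    (f := fun ε θ => 2 * ‖v‖ ^ 2 * (anyonEnergy α ψ j (γ ε θ) + anyonEnergy α ψ k (γ ε θ)))
    hEc 0 Real.pi
  have := le_of_tendsto_of_tendsto
    (((continuous_const (y := Calpha α n ^ 2)).mul h1).continuousAt.tendsto.mono_left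
      nhdsWithin_le_nhds)
    (h2.continuousAt.tendsto.mono_left nhdsWithin_le_nhds) hineq
  simpa only [← hγ, hξ0, Pi.mul_apply] using this

end Circle

section PairMaps

variable {n : ℕ}

/-- Rotation of the relative position of particles `j` and `k` by the angle `θ`. -/
noncomputable def pairRot (j k : Fin n) (θ : ℝ) : (Fin n → Plane) →ₗ[ℝ] (Fin n → Plane) where
  toFun x := pairPos j k x ((2⁻¹ : ℝ) • (x j + x k)) (planeRot θ ((2⁻¹ : ℝ) • (x j - x k)))
  map_add' x y := by
    funext l; ext i
    fin_cases i <;> simp only [pairPos, Pi.add_apply] <;> split_ifs <;> simp <;> ring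
  map_smul' r x := by
    funext l; ext i
    fin_cases i <;> simp only [pairPos, Pi.smul_apply] <;> split_ifs <;> simp <;> ring

lemma pairRot_apply (j k : Fin n) (θ : ℝ) (x : Fin n → Plane) :
    pairRot j k θ x
      = pairPos j k x ((2⁻¹ : ℝ) • (x j + x k)) (planeRot θ ((2⁻¹ : ℝ) • (x j - x k))) := rfl

lemma planeRot_neg_planeRot (θ : ℝ) (v : Plane) : planeRot (-θ) (planeRot θ v) = v := by
  have h := Real.sin_sq_add_cos_sq θ
  ext i
  fin_cases i
  · simp; linear_combination (v 0) * h
  · simp; linear_combination (v 1) * h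

lemma pairRot_neg_comp {j k : Fin n} (hjk : j ≠ k) (θ : ℝ) :
    pairRot j k (-θ) ∘ₗ pairRot j k θ = LinearMap.id := by
  refine LinearMap.ext fun x => ?_
  rw [LinearMap.comp_apply, pairRot_apply j k (-θ)]
  have h1 : pairRot j k θ x j
    = (2⁻¹ : ℝ) • (x j + x k) + planeRot θ ((2⁻¹ : ℝ) • (x j - x k)) := pairPos_left _ _ _
  have h2 : pairRot j k θ x k
    = (2⁻¹ : ℝ) • (x j + x k) - planeRot θ ((2⁻¹ : ℝ) • (x j - x k)) := pairPos_right _ _ _ hjk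
  have h3 : (2⁻¹ : ℝ) • (pairRot j k θ x j + pairRot j k θ x k) = (2⁻¹ : ℝ) • (x j + x k) := by
    rw [h1, h2]; module
  have h4 : (2⁻¹ : ℝ) • (pairRot j k θ x j - pairRot j k θ x k)
      = planeRot θ ((2⁻¹ : ℝ) • (x j - x k)) := by
    rw [h1, h2]; module
  rw [h3, h4, planeRot_neg_planeRot]
  funext l
  rcases eq_or_ne l j with rfl | hj
  · rw [pairPos_left, LinearMap.id_apply]; module
  rcases eq_or_ne l k with rfl | hk
  · rw [pairPos_right _ _ _ hjk, LinearMap.id_apply]; module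
  · rw [pairPos_other _ _ _ hj hk, LinearMap.id_apply, pairRot_apply, pairPos_other _ _ _ hj hk]

/-- Reflection of all particles in the first coordinate axis. -/
noncomputable def allReflect (n : ℕ) : (Fin n → Plane) →ₗ[ℝ] (Fin n → Plane) where
  toFun x l := !₂[x l 0, -(x l 1)]
  map_add' x y := by
    funext l; ext i; fin_cases i <;> simp; ring
  map_smul' r x := by
    funext l; ext i; fin_cases i <;> simp

lemma allReflect_conj (j k : Fin n) (θ : ℝ) :
    allReflect n ∘ₗ pairRot j k θ ∘ₗ allReflect n = pairRot j k (-θ) := by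
  refine LinearMap.ext fun x => ?_
  funext l; ext i
  fin_cases i <;>
    simp only [allReflect, pairRot, LinearMap.comp_apply, LinearMap.coe_mk, AddHom.coe_mk,
      pairPos] <;> split_ifs <;> simp <;> ring

lemma allReflect_comp_self : allReflect n ∘ₗ allReflect n = LinearMap.id := by
  refine LinearMap.ext fun x => ?_
  funext l; ext i
  fin_cases i <;> simp [allReflect]

lemma det_pairRot_sq {j k : Fin n} (hjk : j ≠ k) (θ : ℝ) :
    LinearMap.det (pairRot j k θ) ^ 2 = 1 := by
  have h1 := congrArg LinearMap.det (pairRot_neg_comp hjk θ)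
  have h2 := congrArg LinearMap.det (allReflect_conj j k θ)
  have h3 := congrArg LinearMap.det (allReflect_comp_self (n := n))
  rw [LinearMap.det_comp, LinearMap.det_id] at h1 h3
  rw [LinearMap.det_comp, LinearMap.det_comp] at h2
  rw [← h2] at h1
  linear_combination h1 - LinearMap.det (pairRot j k θ) ^ 2 * h3

lemma measurePreserving_pairRot {j k : Fin n} (hjk : j ≠ k) (θ : ℝ) :
    MeasurePreserving (pairRot j k θ) := by
  have h := det_pairRot_sq hjk θ
  have h0 : LinearMap.det (pairRot j k θ) ≠ 0 := by
    intro h0; rw [h0] at h; norm_num at h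
  refine ⟨(LinearMap.continuous_of_finiteDimensional _).measurable, ?_⟩
  rw [Measure.map_linearMap_addHaar_eq_smul_addHaar _ h0, abs_inv]
  have h1 : |LinearMap.det (pairRot j k θ)| = 1 := by
    rw [← sq_abs] at h
    exact (pow_eq_one_iff_of_nonneg (abs_nonneg _) two_ne_zero).1 h
  rw [h1]; simp

/-- Dilation of the positions of particles `j` and `k` around the point `c`. -/
noncomputable def pairScale (j k : Fin n) (c : Plane) (t : ℝ) (x : Fin n → Plane) : Fin n → Plane :=
  fun l => if l = j ∨ l = k then c + t • (x l - c) else x l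

lemma lintegral_comp_pairScale {j k : Fin n} (hjk : j ≠ k) (c : Plane) {t : ℝ} (ht : 0 < t)
    {F : (Fin n → Plane) → ENNReal} (hF : Measurable F) :
    ∫⁻ x, F (pairScale j k c t x) = ENNReal.ofReal ((t ^ 4)⁻¹) * ∫⁻ x, F x := by
  set M : (Fin n → Plane) →ₗ[ℝ] (Fin n → Plane) := LinearMap.pi fun l =>
    ((if l = j ∨ l = k then t else 1 : ℝ) • LinearMap.id) ∘ₗ LinearMap.proj l with hM
  have hdet : LinearMap.det M = t ^ 4 := by
    rw [hM, LinearMap.det_pi]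
    simp only [LinearMap.det_smul, LinearMap.det_id, mul_one, finrank_euclideanSpace_fin]
    rw [Finset.prod_pow, Finset.prod_ite, Finset.prod_const, Finset.prod_const_one, mul_one]
    have : Finset.univ.filter (fun l : Fin n => l = j ∨ l = k) = {j, k} := by ext l; simp
    rw [this, Finset.card_pair hjk]
    ring
  have hMc : Continuous M := LinearMap.continuous_of_finiteDimensional _
  have hdet0 : LinearMap.det M ≠ 0 := by rw [hdet]; positivity
  set d : Fin n → Plane := fun _ => c
  have hS : ∀ x, pairScale j k c t x = M (x - d) + d := by
    intro x
    funext l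
    simp only [pairScale, hM, LinearMap.pi_apply, LinearMap.comp_apply, LinearMap.proj_apply,
      LinearMap.smul_apply, LinearMap.id_apply, Pi.add_apply, Pi.sub_apply, d]
    split_ifs
    · rw [add_comm]
    · simp
  calc ∫⁻ x, F (pairScale j k c t x) = ∫⁻ x, F (M x + d) := by
        simp_rw [hS]
        exact lintegral_sub_right_eq_self (fun x => F (M x + d)) d
    _ = ∫⁻ y, F (y + d) ∂(Measure.map M volume) := by
        exact (lintegral_map (hF.comp (measurable_add_const d)) hMc.measurable).symm
    _ = _ := by
        rw [Measure.map_linearMap_addHaar_eq_smul_addHaar _ hdet0, lintegral_smul_measure,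
          lintegral_add_right_eq_self F d, hdet, abs_of_pos (by positivity), smul_eq_mul]

end PairMaps

section Pair

variable {α : ℝ} {n : ℕ} {ψ : (Fin n → Plane) → ℂ}

lemma Continuous.pairRot {Y : Type*} [TopologicalSpace Y] {f : Y → ℝ} {g : Y → Fin n → Plane}
    (hf : Continuous f) (hg : Continuous g) (j k : Fin n) :
    Continuous fun y => pairRot j k (f y) (g y) := by
  have hc : ∀ l, Continuous fun y => g y l := fun l => (continuous_apply l).comp hg
  have h := hf.planeRot (((hc j).sub (hc k)).const_smul (2⁻¹ : ℝ))
  simp only [pairRot_apply]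
  refine continuous_pi fun l => ?_
  simp only [pairPos]
  split_ifs
  · exact (((hc j).add (hc k)).const_smul (2⁻¹ : ℝ)).add h
  · exact (((hc j).add (hc k)).const_smul (2⁻¹ : ℝ)).sub h
  · exact hc l

/-- Averaging the circle inequality over all relative positions. -/
lemma pair_rotation_average (hψ : ContDiff ℝ (⊤ : ℕ∞) ψ)
    (hsym : ∀ (σ : Equiv.Perm (Fin n)) (x : Fin n → Plane), ψ (x ∘ σ) = ψ x)
    (hsupp : ∀ x ∈ tsupport ψ, ∀ j k : Fin n, j ≠ k → x j ≠ x k)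
    {j k : Fin n} (hjk : j ≠ k) {w : (Fin n → Plane) → ENNReal} (hw : Measurable w)
    (hinv : ∀ θ x, w (pairRot j k θ x) = w x) {R : ℝ}
    (hR : ∀ x, w x ≠ 0 → 2 * ‖(2⁻¹ : ℝ) • (x j - x k)‖ ^ 2 ≤ R) :
    ENNReal.ofReal (Calpha α n ^ 2) * ∫⁻ x, w x * ENNReal.ofReal (‖ψ x‖ ^ 2)
      ≤ ENNReal.ofReal R *
        ∫⁻ x, w x * ENNReal.ofReal (anyonEnergy α ψ j x + anyonEnergy α ψ k x) := by
  set f : (Fin n → Plane) → ℝ := fun x => ‖ψ x‖ ^ 2 with hf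
  set E : (Fin n → Plane) → ℝ := fun x => anyonEnergy α ψ j x + anyonEnergy α ψ k x with hE
  have hfc : Continuous f := hψ.continuous.norm.pow 2
  have hEc : Continuous E :=
    (continuous_anyonEnergy hψ hsupp j).add (continuous_anyonEnergy hψ hsupp k)
  have hf0 : ∀ x, 0 ≤ f x := fun x => by positivity
  have hE0 : ∀ x, 0 ≤ E x := fun x =>
    add_nonneg (anyonEnergy_nonneg _ _ _ _) (anyonEnergy_nonneg _ _ _ _)
  set ν : Measure ℝ := volume.restrict (Set.Ioc 0 Real.pi) with hν
  have hcr : ∀ x, Continuous fun θ => pairRot j k θ x := fun x =>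
    continuous_id.pairRot continuous_const j k
  have hconv : ∀ g : (Fin n → Plane) → ℝ, Continuous g → (∀ x, 0 ≤ g x) → ∀ x,
      ENNReal.ofReal (∫ θ in (0 : ℝ)..Real.pi, g (pairRot j k θ x))
        = ∫⁻ θ, ENNReal.ofReal (g (pairRot j k θ x)) ∂ν := by
    intro g hg hg0 x
    rw [intervalIntegral.integral_of_le Real.pi_pos.le, ofReal_integral_eq_lintegral_ofReal]
    · exact ((hg.comp (hcr x)).integrableOn_Icc).mono_set Set.Ioc_subset_Icc_self
    · exact Filter.Eventually.of_forall fun θ => hg0 _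
  have hpt : ∀ x, ENNReal.ofReal (Calpha α n ^ 2) *
      ∫⁻ θ, w x * ENNReal.ofReal (f (pairRot j k θ x)) ∂ν
      ≤ ENNReal.ofReal R * ∫⁻ θ, w x * ENNReal.ofReal (E (pairRot j k θ x)) ∂ν := by
    intro x
    have hc := circle_poincare (α := α) hψ hsym hsupp hjk x ((2⁻¹ : ℝ) • (x j + x k))
      ((2⁻¹ : ℝ) • (x j - x k))
    simp only [← pairRot_apply, intervalIntegral.integral_const_mul] at hc
    have hc' := ENNReal.ofReal_le_ofReal hc
    rw [ENNReal.ofReal_mul (by positivity), ENNReal.ofReal_mul (by positivity),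
      hconv f hfc hf0, hconv E hEc hE0] at hc'
    have hm : ∀ g : (Fin n → Plane) → ℝ, Continuous g →
        ∫⁻ θ, w x * ENNReal.ofReal (g (pairRot j k θ x)) ∂ν
          = w x * ∫⁻ θ, ENNReal.ofReal (g (pairRot j k θ x)) ∂ν := fun g hg =>
      lintegral_const_mul _ ((hg.comp (hcr x)).measurable.ennreal_ofReal)
    rw [hm f hfc, hm E hEc]
    rcases eq_or_ne (w x) 0 with h0 | h0
    · simp [h0]
    calc _ = w x * (ENNReal.ofReal (Calpha α n ^ 2) *
          ∫⁻ θ, ENNReal.ofReal (f (pairRot j k θ x)) ∂ν) := by ring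
      _ ≤ w x * (ENNReal.ofReal R * ∫⁻ θ, ENNReal.ofReal (E (pairRot j k θ x)) ∂ν) :=
          mul_le_mul' le_rfl (hc'.trans
            (mul_le_mul' (ENNReal.ofReal_le_ofReal (hR x h0)) le_rfl))
      _ = _ := by ring
  have hswap : ∀ g : (Fin n → Plane) → ℝ, Continuous g →
      ∫⁻ x, ∫⁻ θ, w x * ENNReal.ofReal (g (pairRot j k θ x)) ∂ν
        = ENNReal.ofReal Real.pi * ∫⁻ x, w x * ENNReal.ofReal (g x) := by
    intro g hg
    rw [lintegral_lintegral_swap]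
    · have : ∀ θ, ∫⁻ x, w x * ENNReal.ofReal (g (pairRot j k θ x))
          = ∫⁻ x, w x * ENNReal.ofReal (g x) := fun θ => by
        have h := (measurePreserving_pairRot hjk θ).lintegral_comp
          (hw.mul hg.measurable.ennreal_ofReal)
        simpa only [Pi.mul_apply, hinv] using h
      simp only [this, lintegral_const, hν, Measure.restrict_apply_univ, Real.volume_Ioc, sub_zero]
      rw [mul_comm]
    · exact ((hw.comp measurable_fst).mul
        (hg.comp (continuous_snd.pairRot continuous_fst j k)).measurable.ennreal_ofReal).aemeasurable
  have hmeas : ∀ g : (Fin n → Plane) → ℝ, Continuous g →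
      Measurable fun x => ∫⁻ θ, w x * ENNReal.ofReal (g (pairRot j k θ x)) ∂ν := fun g hg =>
    Measurable.lintegral_prod_right' (f := fun p : (Fin n → Plane) × ℝ =>
      w p.1 * ENNReal.ofReal (g (pairRot j k p.2 p.1))) ((hw.comp measurable_fst).mul
        (hg.comp (continuous_snd.pairRot continuous_fst j k)).measurable.ennreal_ofReal)
  have h := lintegral_mono (μ := volume) hpt
  rw [lintegral_const_mul _ (hmeas f hfc), lintegral_const_mul _ (hmeas E hEc), hswap f hfc,
    hswap E hEc, mul_left_comm, mul_left_comm (ENNReal.ofReal R)] at h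
  exact (ENNReal.mul_le_mul_iff_right (by simpa using Real.pi_pos) ENNReal.ofReal_ne_top).1 h

end Pair

section Dilation

variable {α : ℝ} {n : ℕ} {ψ : (Fin n → Plane) → ℂ}

lemma pairScale_one (j k : Fin n) (c : Plane) (x : Fin n → Plane) : pairScale j k c 1 x = x := by
  funext l; simp [pairScale]

lemma Continuous.pairScale {Y : Type*} [TopologicalSpace Y] {f : Y → ℝ} {g : Y → Fin n → Plane}
    (hf : Continuous f) (hg : Continuous g) (j k : Fin n) (c : Plane) :
    Continuous fun y => pairScale j k c (f y) (g y) := by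
  have hc : ∀ l, Continuous fun y => g y l := fun l => (continuous_apply l).comp hg
  refine continuous_pi fun l => ?_
  simp only [_root_.pairScale]
  split_ifs
  · exact continuous_const.add (hf.smul ((hc l).sub continuous_const))
  · exact hc l

lemma hasDerivAt_pairScale {j k : Fin n} (hjk : j ≠ k) (c : Plane) (x : Fin n → Plane) (t : ℝ) :
    HasDerivAt (fun t => pairScale j k c t x)
      (Pi.single j (x j - c) + Pi.single k (x k - c)) t := by
  rw [hasDerivAt_pi]
  intro l
  have h : ∀ v : Plane, HasDerivAt (fun t : ℝ => c + t • v) v t := fun v => by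
    simpa using ((hasDerivAt_id t).smul_const v).const_add c
  rcases eq_or_ne l j with rfl | hj
  · simpa [pairScale, hjk] using h (x l - c)
  rcases eq_or_ne l k with rfl | hk
  · simpa [pairScale, hj] using h (x l - c)
  · simpa [pairScale, hj, hk] using hasDerivAt_const t (x l)

/-- Growth of `|ψ|²` along a dilation of the positions of two particles. -/
lemma sq_norm_le_dilation (hψ : ContDiff ℝ (⊤ : ℕ∞) ψ)
    (hsupp : ∀ x ∈ tsupport ψ, ∀ j k : Fin n, j ≠ k → x j ≠ x k)
    {j k : Fin n} (hjk : j ≠ k) (c : Plane) (x : Fin n → Plane) {L η : ℝ} (hη : 0 < η)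
    (hx : ‖x j - c‖ ^ 2 + ‖x k - c‖ ^ 2 ≤ L ^ 2) :
    ‖ψ x‖ ^ 2 ≤ ‖ψ (pairScale j k c (1 / 2) x)‖ ^ 2 +
      ∫ t in (1 / 2 : ℝ)..1, (η * ‖ψ (pairScale j k c t x)‖ ^ 2 + η⁻¹ * L ^ 2 *
        (anyonEnergy α ψ j (pairScale j k c t x) + anyonEnergy α ψ k (pairScale j k c t x))) := by
  obtain ⟨γ, hγ⟩ : ∃ γ : ℝ → Fin n → Plane, ∀ t, pairScale j k c t x = γ t := ⟨_, fun _ => rfl⟩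
  have hγd := hasDerivAt_pairScale hjk c x
  have hγ1 : γ 1 = x := by rw [← hγ, pairScale_one]
  have hγc : Continuous γ := by
    rw [← funext hγ]; exact continuous_id.pairScale continuous_const j k c
  simp only [hγ] at hγd ⊢
  set h : Fin n → Plane := Pi.single j (x j - c) + Pi.single k (x k - c) with hh
  have hd : ∀ y, HasFDerivAt ψ (fderiv ℝ ψ y) y := fun y =>
    ((hψ.differentiable (by simp)) y).hasFDerivAt
  have hg : ∀ t, HasDerivAt (fun t => ‖ψ (γ t)‖ ^ 2)
      (2 * inner ℝ (ψ (γ t)) (fderiv ℝ ψ (γ t) h)) t := fun t =>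
    ((hd (γ t)).comp_hasDerivAt t (hγd t)).norm_sq
  have hψγ : Continuous fun t => ψ (γ t) := hψ.continuous.comp hγc
  have hdψ : Continuous fun t => fderiv ℝ ψ (γ t) h :=
    ((hψ.continuous_fderiv (by simp)).comp hγc).clm_apply continuous_const
  have hgc : Continuous fun t => 2 * inner ℝ (ψ (γ t)) (fderiv ℝ ψ (γ t) h) :=
    continuous_const.mul (hψγ.inner hdψ)
  have hE : ∀ i, Continuous fun t => anyonEnergy α ψ i (γ t) := fun i =>
    (continuous_anyonEnergy hψ hsupp i).comp hγc
  have hftc := intervalIntegral.integral_eq_sub_of_hasDerivAt (a := 1 / 2) (b := 1)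
    (fun t _ => hg t) (hgc.intervalIntegrable _ _)
  rw [hγ1] at hftc
  have hmono : ∫ t in (1 / 2 : ℝ)..1, 2 * inner ℝ (ψ (γ t)) (fderiv ℝ ψ (γ t) h)
      ≤ ∫ t in (1 / 2 : ℝ)..1, (η * ‖ψ (γ t)‖ ^ 2 + η⁻¹ * L ^ 2 *
        (anyonEnergy α ψ j (γ t) + anyonEnergy α ψ k (γ t))) := by
    refine intervalIntegral.integral_mono_on (by norm_num) (hgc.intervalIntegrable _ _)
      (((continuous_const.mul (hψγ.norm.pow 2)).add
        (continuous_const.mul ((hE j).add (hE k)))).intervalIntegrable _ _) fun t _ => ?_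
    refine (le_abs_self _).trans ((abs_inner_fderiv_le (γ t) h _
      ((∑ i, (x j - c) i * anyonA α (γ t) j i) + ∑ i, (x k - c) i * anyonA α (γ t) k i) rfl).trans ?_)
    have hD : -Complex.I * fderiv ℝ ψ (γ t) h
        + (((∑ i, (x j - c) i * anyonA α (γ t) j i)
          + ∑ i, (x k - c) i * anyonA α (γ t) k i : ℝ) : ℂ) * ψ (γ t)
        = (∑ i, ((x j - c) i : ℂ) * anyonD α ψ (γ t) j i)
          + ∑ i, ((x k - c) i : ℂ) * anyonD α ψ (γ t) k i := by
      rw [← neg_I_mul_fderiv_single, ← neg_I_mul_fderiv_single, hh, map_add]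
      push_cast
      ring
    rw [hD]
    have hle := norm_pair_derivative_sq_le (α := α) (ψ := ψ) (γ t) j k (x j - c) (x k - c)
    set D := (∑ i, ((x j - c) i : ℂ) * anyonD α ψ (γ t) j i)
          + ∑ i, ((x k - c) i : ℂ) * anyonD α ψ (γ t) k i
    have hE0 : 0 ≤ anyonEnergy α ψ j (γ t) + anyonEnergy α ψ k (γ t) :=
      add_nonneg (anyonEnergy_nonneg _ _ _ _) (anyonEnergy_nonneg _ _ _ _)
    have h2 : ‖D‖ ^ 2 ≤ L ^ 2 * (anyonEnergy α ψ j (γ t) + anyonEnergy α ψ k (γ t)) :=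
      hle.trans (mul_le_mul_of_nonneg_right hx hE0)
    have h3 : 2 * (‖ψ (γ t)‖ * ‖D‖) ≤ η * ‖ψ (γ t)‖ ^ 2 + η⁻¹ * ‖D‖ ^ 2 := by
      have h4 : η * ‖ψ (γ t)‖ ^ 2 + η⁻¹ * ‖D‖ ^ 2 - 2 * (‖ψ (γ t)‖ * ‖D‖)
          = η⁻¹ * (η * ‖ψ (γ t)‖ - ‖D‖) ^ 2 := by field_simp; ring
      have h5 : 0 ≤ η⁻¹ * (η * ‖ψ (γ t)‖ - ‖D‖) ^ 2 := by positivity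
      linarith
    have h6 := mul_le_mul_of_nonneg_left h2 (inv_pos.2 hη).le
    rw [← mul_assoc] at h6
    linarith
  linarith

end Dilation

/-- The half-open square with lower left corner `(a, b)` and side length `L`. -/
def planeSquare (a b L : ℝ) : Set Plane :=
  {y | y 0 ∈ Set.Ico a (a + L) ∧ y 1 ∈ Set.Ico b (b + L)}

lemma measurableSet_planeSquare (a b L : ℝ) : MeasurableSet (planeSquare a b L) :=
  ((by fun_prop : Measurable fun y : Plane => y 0) measurableSet_Ico).inter
    ((by fun_prop : Measurable fun y : Plane => y 1) measurableSet_Ico)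

/-- The configurations with both particles `j` and `k` in the set `Q`. -/
def pairIn {n : ℕ} (j k : Fin n) (Q : Set Plane) : Set (Fin n → Plane) := {x | x j ∈ Q ∧ x k ∈ Q}

lemma measurableSet_pairIn {n : ℕ} (j k : Fin n) {Q : Set Plane} (hQ : MeasurableSet Q) :
    MeasurableSet (pairIn j k Q) :=
  (measurable_pi_apply j hQ).inter (measurable_pi_apply k hQ)

/-- The configurations with particles `j` and `k` jointly close to the point `c`. -/
def pairNear {n : ℕ} (j k : Fin n) (c : Plane) (r : ℝ) : Set (Fin n → Plane) :=
  {x | ‖x j - c‖ ^ 2 + ‖x k - c‖ ^ 2 < r}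

lemma measurableSet_pairNear {n : ℕ} (j k : Fin n) (c : Plane) (r : ℝ) :
    MeasurableSet (pairNear j k c r) := by
  refine measurableSet_lt ?_ measurable_const
  exact Continuous.measurable (by fun_prop)

lemma planeSquare_iff_center {a b L : ℝ} (y : Plane) :
    y ∈ planeSquare a b L ↔
      (-(L / 2) ≤ (y - !₂[a + L / 2, b + L / 2]) 0 ∧ (y - !₂[a + L / 2, b + L / 2]) 0 < L / 2) ∧
      (-(L / 2) ≤ (y - !₂[a + L / 2, b + L / 2]) 1 ∧ (y - !₂[a + L / 2, b + L / 2]) 1 < L / 2) := by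
  simp only [planeSquare, Set.mem_ofPred_eq, Set.mem_Ico, PiLp.sub_apply]
  simp
  constructor <;> rintro ⟨⟨h1, h2⟩, h3, h4⟩ <;> refine ⟨⟨?_, ?_⟩, ?_, ?_⟩ <;> linarith

section PairGeometry

variable {n : ℕ} {j k : Fin n} {a b L : ℝ}

lemma pairNear_subset_pairIn (hL : 0 < L) :
    pairNear j k !₂[a + L / 2, b + L / 2] (L ^ 2 / 4) ⊆ pairIn j k (planeSquare a b L) := by
  intro x hx
  simp only [pairNear, Set.mem_ofPred_eq, Plane.norm_sq] at hx
  simp only [pairIn, Set.mem_ofPred_eq, planeSquare_iff_center]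
  set p := x j - !₂[a + L / 2, b + L / 2]
  set q := x k - !₂[a + L / 2, b + L / 2]
  have key : ∀ s : ℝ, s ^ 2 < (L / 2) ^ 2 → -(L / 2) ≤ s ∧ s < L / 2 := fun s hs => by
    have := abs_lt_of_sq_lt_sq' hs (by positivity)
    exact ⟨this.1.le, this.2⟩
  refine ⟨⟨key _ ?_, key _ ?_⟩, key _ ?_, key _ ?_⟩ <;>
    nlinarith [sq_nonneg (p 0), sq_nonneg (p 1), sq_nonneg (q 0), sq_nonneg (q 1)]

lemma pairNear_pairRot (hjk : j ≠ k) (c : Plane) (r θ : ℝ) (x : Fin n → Plane) :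
    pairRot j k θ x ∈ pairNear j k c r ↔ x ∈ pairNear j k c r := by
  have h1 : pairRot j k θ x j - c
      = ((2⁻¹ : ℝ) • (x j + x k) - c) + planeRot θ ((2⁻¹ : ℝ) • (x j - x k)) := by
    rw [pairRot_apply, pairPos_left]; abel
  have h2 : pairRot j k θ x k - c
      = ((2⁻¹ : ℝ) • (x j + x k) - c) - planeRot θ ((2⁻¹ : ℝ) • (x j - x k)) := by
    rw [pairRot_apply, pairPos_right _ _ _ hjk]; abel
  have h3 : x j - c = ((2⁻¹ : ℝ) • (x j + x k) - c) + (2⁻¹ : ℝ) • (x j - x k) := by module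
  have h4 : x k - c = ((2⁻¹ : ℝ) • (x j + x k) - c) - (2⁻¹ : ℝ) • (x j - x k) := by module
  simp only [pairNear, Set.mem_ofPred_eq, h1, h2]
  rw [h3, h4]
  have h5 := parallelogram_law_with_norm ℝ ((2⁻¹ : ℝ) • (x j + x k) - c)
    (planeRot θ ((2⁻¹ : ℝ) • (x j - x k)))
  have h6 := parallelogram_law_with_norm ℝ ((2⁻¹ : ℝ) • (x j + x k) - c)
    ((2⁻¹ : ℝ) • (x j - x k))
  rw [norm_planeRot] at h5
  rw [h5, h6]

lemma pairScale_left (c : Plane) (t : ℝ) (x : Fin n → Plane) :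
    pairScale j k c t x j = c + t • (x j - c) := by simp [pairScale]

lemma pairScale_right (c : Plane) (t : ℝ) (x : Fin n → Plane) :
    pairScale j k c t x k = c + t • (x k - c) := by simp [pairScale]

lemma pairIn_pairScale {t : ℝ} (ht0 : 0 < t) (ht1 : t ≤ 1) {x : Fin n → Plane}
    (hx : x ∈ pairIn j k (planeSquare a b L)) :
    pairScale j k !₂[a + L / 2, b + L / 2] t x ∈ pairIn j k (planeSquare a b L) := by
  simp only [pairIn, Set.mem_ofPred_eq, planeSquare_iff_center, pairScale_left, pairScale_right,
    add_sub_cancel_left, PiLp.smul_apply, smul_eq_mul] at hx ⊢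
  have key : ∀ s : ℝ, -(L / 2) ≤ s ∧ s < L / 2 → -(L / 2) ≤ t * s ∧ t * s < L / 2 := by
    rintro s ⟨h1, h2⟩
    constructor
    · nlinarith
    · rcases le_or_gt 0 s with hs | hs <;> nlinarith
  exact ⟨⟨key _ hx.1.1, key _ hx.1.2⟩, key _ hx.2.1, key _ hx.2.2⟩

lemma norm_sq_le_of_mem_pairIn {x : Fin n → Plane} (hx : x ∈ pairIn j k (planeSquare a b L)) :
    ‖x j - !₂[a + L / 2, b + L / 2]‖ ^ 2 + ‖x k - !₂[a + L / 2, b + L / 2]‖ ^ 2 ≤ L ^ 2 := by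
  simp only [pairIn, Set.mem_ofPred_eq, planeSquare_iff_center] at hx
  rw [Plane.norm_sq, Plane.norm_sq]
  obtain ⟨⟨⟨h1, h2⟩, h3, h4⟩, ⟨h5, h6⟩, h7, h8⟩ := hx
  nlinarith

lemma eq_or_pairNear_pairScale {x : Fin n → Plane} (hx : x ∈ pairIn j k (planeSquare a b L)) :
    x j = x k ∨
      pairScale j k !₂[a + L / 2, b + L / 2] (1 / 2) x
        ∈ pairNear j k !₂[a + L / 2, b + L / 2] (L ^ 2 / 4) := by
  rw [or_iff_not_imp_right]
  intro h
  simp only [pairIn, Set.mem_ofPred_eq, planeSquare_iff_center] at hx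
  simp only [pairNear, Set.mem_ofPred_eq, pairScale_left, pairScale_right,
    add_sub_cancel_left, Plane.norm_sq, not_lt] at h
  obtain ⟨⟨⟨h1, h2⟩, h3, h4⟩, ⟨h5, h6⟩, h7, h8⟩ := hx
  set c : Plane := !₂[a + L / 2, b + L / 2]
  norm_num at h
  have key : ∀ s : ℝ, -(L / 2) ≤ s → s < L / 2 → 0 ≤ (s + L / 2) * (L / 2 - s) := fun s h h' =>
    mul_nonneg (by linarith) (by linarith)
  have key2 : ∀ s : ℝ, -(L / 2) ≤ s → s < L / 2 → (s + L / 2) * (L / 2 - s) ≤ 0 → s = -(L / 2) := by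
    intro s h h' h0
    nlinarith
  have e1 := key _ h1 h2
  have e2 := key _ h3 h4
  have e3 := key _ h5 h6
  have e4 := key _ h7 h8
  simp only [PiLp.sub_apply] at *
  have f1 := key2 _ h1 h2 (by nlinarith)
  have f2 := key2 _ h3 h4 (by nlinarith)
  have f3 := key2 _ h5 h6 (by nlinarith)
  have f4 := key2 _ h7 h8 (by nlinarith)
  ext i
  fin_cases i
  · simp; linarith
  · simp; linarith

end PairGeometry

lemma lintegral_inv_pow_four :
    ∫⁻ t in Set.Ioc (1 / 2 : ℝ) 1, ENNReal.ofReal ((t ^ 4)⁻¹) = ENNReal.ofReal (7 / 3) := by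
  have hi : IntervalIntegrable (fun t : ℝ => (t ^ 4)⁻¹) volume (1 / 2) 1 := by
    refine ContinuousOn.intervalIntegrable fun t ht => ?_
    rw [Set.uIcc_of_le (by norm_num)] at ht
    have : t ≠ 0 := by linarith [ht.1]
    exact ContinuousAt.continuousWithinAt (by fun_prop (disch := positivity))
  rw [← ofReal_integral_eq_lintegral_ofReal, ← intervalIntegral.integral_of_le (by norm_num)]
  · have := integral_zpow (a := 1 / 2) (b := 1) (n := -4) (Or.inr ⟨by norm_num, by
      rw [Set.uIcc_of_le (by norm_num)]; norm_num⟩)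
    have h2 : ∀ t : ℝ, t ^ (-4 : ℤ) = (t ^ 4)⁻¹ := fun t => by
      rw [zpow_neg]; norm_cast
    simp only [h2] at this
    rw [this]
    norm_num
  · exact (intervalIntegrable_iff_integrableOn_Ioc_of_le (by norm_num)).1 hi
  · exact Filter.Eventually.of_forall fun t => by positivity

section Exclusion

variable {α : ℝ} {n : ℕ} {ψ : (Fin n → Plane) → ℂ}

/-- Integrated growth along dilations: the mass of two particles in a square is controlled by
the mass in the inscribed ball and the energy. -/
lemma lintegral_pairIn_le (hψ : ContDiff ℝ (⊤ : ℕ∞) ψ)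
    (hsupp : ∀ x ∈ tsupport ψ, ∀ j k : Fin n, j ≠ k → x j ≠ x k)
    {j k : Fin n} (hjk : j ≠ k) {a b L η : ℝ} (hη : 0 < η)
    {W : (Fin n → Plane) → ENNReal} (hW : Measurable W)
    (hWdep : ∀ x y : Fin n → Plane, (∀ l, l ≠ j → l ≠ k → x l = y l) → W x = W y) :
    ∫⁻ x, (pairIn j k (planeSquare a b L)).indicator W x * ENNReal.ofReal (‖ψ x‖ ^ 2)
      ≤ 16 * (∫⁻ x, (pairNear j k !₂[a + L / 2, b + L / 2] (L ^ 2 / 4)).indicator W x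
            * ENNReal.ofReal (‖ψ x‖ ^ 2))
        + ENNReal.ofReal (7 / 3) * (ENNReal.ofReal η *
          (∫⁻ x, (pairIn j k (planeSquare a b L)).indicator W x * ENNReal.ofReal (‖ψ x‖ ^ 2))
        + ENNReal.ofReal (η⁻¹ * L ^ 2) *
          ∫⁻ x, (pairIn j k (planeSquare a b L)).indicator W x *
            ENNReal.ofReal (anyonEnergy α ψ j x + anyonEnergy α ψ k x)) := by
  set c : Plane := !₂[a + L / 2, b + L / 2] with hc
  set wG := (pairIn j k (planeSquare a b L)).indicator W with hwG
  set wB := (pairNear j k c (L ^ 2 / 4)).indicator W with hwB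
  set f : (Fin n → Plane) → ℝ := fun x => ‖ψ x‖ ^ 2 with hf
  set E : (Fin n → Plane) → ℝ := fun x => anyonEnergy α ψ j x + anyonEnergy α ψ k x with hE
  have hwGm : Measurable wG := hW.indicator (measurableSet_pairIn j k (measurableSet_planeSquare _ _ _))
  have hwBm : Measurable wB := hW.indicator (measurableSet_pairNear _ _ _ _)
  have hfc : Continuous f := hψ.continuous.norm.pow 2
  have hEc : Continuous E :=
    (continuous_anyonEnergy hψ hsupp j).add (continuous_anyonEnergy hψ hsupp k)
  have hf0 : ∀ x, 0 ≤ f x := fun x => by positivity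
  have hE0 : ∀ x, 0 ≤ E x := fun x =>
    add_nonneg (anyonEnergy_nonneg _ _ _ _) (anyonEnergy_nonneg _ _ _ _)
  set F : (Fin n → Plane) → ℝ := fun x => η * f x + η⁻¹ * L ^ 2 * E x with hF
  have hFc : Continuous F := (continuous_const.mul hfc).add (continuous_const.mul hEc)
  have hF0 : ∀ x, 0 ≤ F x := fun x => by
    have := hf0 x; have := hE0 x; simp only [hF]; positivity
  have hWS : ∀ t x, W (pairScale j k c t x) = W x := fun t x =>
    hWdep _ _ fun l hj hk => by simp [pairScale, hj, hk]
  set ν : Measure ℝ := volume.restrict (Set.Ioc (1 / 2 : ℝ) 1) with hν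
  have hpt : ∀ x, wG x * ENNReal.ofReal (f x)
      ≤ wB (pairScale j k c (1 / 2) x) * ENNReal.ofReal (f (pairScale j k c (1 / 2) x))
        + ∫⁻ t, wG (pairScale j k c t x) * ENNReal.ofReal (F (pairScale j k c t x)) ∂ν := by
    intro x
    by_cases hx : x ∈ pairIn j k (planeSquare a b L)
    swap
    · simp [hwG, hx]
    have h := sq_norm_le_dilation (α := α) hψ hsupp hjk c x hη (norm_sq_le_of_mem_pairIn hx)
    have hcF : Continuous fun t => F (pairScale j k c t x) :=
      hFc.comp (continuous_id.pairScale continuous_const j k c)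
    have h1 : ENNReal.ofReal (f x) ≤ ENNReal.ofReal (f (pairScale j k c (1 / 2) x))
        + ∫⁻ t, ENNReal.ofReal (F (pairScale j k c t x)) ∂ν := by
      rw [hν, ← ofReal_integral_eq_lintegral_ofReal, ← intervalIntegral.integral_of_le (by norm_num),
        ← ENNReal.ofReal_add]
      · exact ENNReal.ofReal_le_ofReal h
      · exact hf0 _
      · exact intervalIntegral.integral_nonneg (by norm_num) fun t _ => hF0 _
      · exact hcF.integrableOn_Icc.mono_set Set.Ioc_subset_Icc_self
      · exact Filter.Eventually.of_forall fun t => hF0 _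
    have hwx : wG x = W x := Set.indicator_of_mem hx W
    calc wG x * ENNReal.ofReal (f x)
        ≤ W x * (ENNReal.ofReal (f (pairScale j k c (1 / 2) x))
          + ∫⁻ t, ENNReal.ofReal (F (pairScale j k c t x)) ∂ν) := by
          rw [hwx]; exact mul_le_mul' le_rfl h1
      _ = W x * ENNReal.ofReal (f (pairScale j k c (1 / 2) x))
          + ∫⁻ t, W x * ENNReal.ofReal (F (pairScale j k c t x)) ∂ν := by
          rw [mul_add]
          congr 1
          exact (lintegral_const_mul _ hcF.measurable.ennreal_ofReal).symm
      _ ≤ _ := by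
          refine add_le_add ?_ (le_of_eq (setLIntegral_congr_fun measurableSet_Ioc ?_))
          · rcases eq_or_pairNear_pairScale hx with h0 | h0
            · have : ψ (pairScale j k c (1 / 2) x) = 0 :=
                eq_zero_of_coincide hsupp hjk (by rw [pairScale_left, pairScale_right, h0])
              have hf' : f (pairScale j k c (1 / 2) x) = 0 := by simp only [hf, this]; simp
              rw [hf']; simp
            · rw [hwB, Set.indicator_of_mem h0, hWS]
          · intro t ht
            simp only
            rw [hwG, Set.indicator_of_mem (pairIn_pairScale (by linarith [ht.1]) ht.2 hx), hWS]
  have hprod : Measurable fun p : (Fin n → Plane) × ℝ =>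
      wG (pairScale j k c p.2 p.1) * ENNReal.ofReal (F (pairScale j k c p.2 p.1)) := by
    have hm : Measurable fun p : (Fin n → Plane) × ℝ => pairScale j k c p.2 p.1 :=
      (continuous_snd.pairScale continuous_fst j k c).measurable
    exact (hwGm.comp hm).mul (hFc.measurable.comp hm).ennreal_ofReal
  have hsum : ∫⁻ x, wG x * ENNReal.ofReal (F x)
      = ENNReal.ofReal η * (∫⁻ x, wG x * ENNReal.ofReal (f x))
        + ENNReal.ofReal (η⁻¹ * L ^ 2) * ∫⁻ x, wG x * ENNReal.ofReal (E x) := by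
    have hmf : Measurable fun x => wG x * ENNReal.ofReal (f x) :=
      hwGm.mul hfc.measurable.ennreal_ofReal
    have hmE : Measurable fun x => wG x * ENNReal.ofReal (E x) :=
      hwGm.mul hEc.measurable.ennreal_ofReal
    rw [← lintegral_const_mul _ hmf, ← lintegral_const_mul _ hmE,
      ← lintegral_add_left (hmf.const_mul _)]
    refine lintegral_congr fun x => ?_
    simp only [hF]
    have := hf0 x
    have := hE0 x
    rw [ENNReal.ofReal_add (by positivity) (by positivity), ENNReal.ofReal_mul hη.le,
      ENNReal.ofReal_mul (by positivity)]
    ring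
  calc ∫⁻ x, wG x * ENNReal.ofReal (f x)
      ≤ ∫⁻ x, (wB (pairScale j k c (1 / 2) x) * ENNReal.ofReal (f (pairScale j k c (1 / 2) x))
        + ∫⁻ t, wG (pairScale j k c t x) * ENNReal.ofReal (F (pairScale j k c t x)) ∂ν) :=
        lintegral_mono hpt
    _ = (∫⁻ x, wB (pairScale j k c (1 / 2) x) * ENNReal.ofReal (f (pairScale j k c (1 / 2) x)))
        + ∫⁻ x, ∫⁻ t, wG (pairScale j k c t x) * ENNReal.ofReal (F (pairScale j k c t x)) ∂ν :=
        lintegral_add_right _ hprod.lintegral_prod_right'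
    _ = 16 * (∫⁻ x, wB x * ENNReal.ofReal (f x))
        + ENNReal.ofReal (7 / 3) * ∫⁻ x, wG x * ENNReal.ofReal (F x) := by
        congr 1
        · rw [lintegral_comp_pairScale hjk c (by norm_num)
            (F := fun x => wB x * ENNReal.ofReal (f x)) (hwBm.mul hfc.measurable.ennreal_ofReal)]
          norm_num
        · rw [lintegral_lintegral_swap hprod.aemeasurable]
          have : ∀ t ∈ Set.Ioc (1 / 2 : ℝ) 1,
              ∫⁻ x, wG (pairScale j k c t x) * ENNReal.ofReal (F (pairScale j k c t x))
                = ENNReal.ofReal ((t ^ 4)⁻¹) * ∫⁻ x, wG x * ENNReal.ofReal (F x) := fun t ht =>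
            lintegral_comp_pairScale hjk c (by linarith [ht.1])
              (F := fun x => wG x * ENNReal.ofReal (F x)) (hwGm.mul hFc.measurable.ennreal_ofReal)
          rw [hν, setLIntegral_congr_fun measurableSet_Ioc this,
            lintegral_mul_const _ (by fun_prop), lintegral_inv_pow_four]
    _ = _ := by rw [hsum]

lemma two_mul_norm_half_sub_sq_le {V : Type*} [NormedAddCommGroup V] [InnerProductSpace ℝ V]
    (p q c : V) : 2 * ‖(2⁻¹ : ℝ) • (p - q)‖ ^ 2 ≤ ‖p - c‖ ^ 2 + ‖q - c‖ ^ 2 := by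
  have h := parallelogram_law_with_norm ℝ (p - c) (q - c)
  rw [sub_sub_sub_cancel_right] at h
  rw [norm_smul, mul_pow]
  have : ‖(2⁻¹ : ℝ)‖ ^ 2 = 1 / 4 := by norm_num
  rw [this]
  nlinarith [sq_nonneg ‖p - c + (q - c)‖]

/-- Two anyons in a common square, weighted by the positions of the other particles. -/
lemma pair_exclusion (hψ : ContDiff ℝ (⊤ : ℕ∞) ψ) (hcs : HasCompactSupport ψ)
    (hsym : ∀ (σ : Equiv.Perm (Fin n)) (x : Fin n → Plane), ψ (x ∘ σ) = ψ x)
    (hsupp : ∀ x ∈ tsupport ψ, ∀ j k : Fin n, j ≠ k → x j ≠ x k)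
    {j k : Fin n} (hjk : j ≠ k) {a b L : ℝ} (hL : 0 < L)
    {W : (Fin n → Plane) → ENNReal} (hW : Measurable W) (hW1 : ∀ x, W x ≤ 1)
    (hWdep : ∀ x y : Fin n → Plane, (∀ l, l ≠ j → l ≠ k → x l = y l) → W x = W y) :
    ENNReal.ofReal (Calpha α n ^ 2) *
        ∫⁻ x, (pairIn j k (planeSquare a b L)).indicator W x * ENNReal.ofReal (‖ψ x‖ ^ 2)
      ≤ ENNReal.ofReal (30 * L ^ 2) *
          ∫⁻ x, (pairIn j k (planeSquare a b L)).indicator W x *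
            ENNReal.ofReal (anyonEnergy α ψ j x + anyonEnergy α ψ k x) := by
  have h1 := lintegral_pairIn_le (α := α) hψ hsupp hjk (a := a) (b := b) (L := L) (η := 1 / 5)
    (by norm_num) hW hWdep
  have hnear : ∀ x ∈ pairNear j k !₂[a + L / 2, b + L / 2] (L ^ 2 / 4),
      ‖x j - !₂[a + L / 2, b + L / 2]‖ ^ 2 + ‖x k - !₂[a + L / 2, b + L / 2]‖ ^ 2 ≤ L ^ 2 / 4 :=
    fun x hx => le_of_lt hx
  have h2 := pair_rotation_average (α := α) hψ hsym hsupp hjk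
    (w := (pairNear j k !₂[a + L / 2, b + L / 2] (L ^ 2 / 4)).indicator W)
    (hW.indicator (measurableSet_pairNear _ _ _ _)) (fun θ x => by
      by_cases hx : x ∈ pairNear j k !₂[a + L / 2, b + L / 2] (L ^ 2 / 4)
      · rw [Set.indicator_of_mem hx, Set.indicator_of_mem ((pairNear_pairRot hjk _ _ _ _).2 hx)]
        exact hWdep _ _ fun l hj hk => by rw [pairRot_apply, pairPos_other _ _ _ hj hk]
      · rw [Set.indicator_of_notMem hx,
          Set.indicator_of_notMem (mt (pairNear_pairRot hjk _ _ _ _).1 hx)]) (R := L ^ 2 / 4)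
    (fun x hx => (two_mul_norm_half_sub_sq_le (x j) (x k) !₂[a + L / 2, b + L / 2]).trans
      (hnear x (Set.mem_of_indicator_ne_zero hx)))
  have hmono : ∀ x, (pairNear j k !₂[a + L / 2, b + L / 2] (L ^ 2 / 4)).indicator W x
      ≤ (pairIn j k (planeSquare a b L)).indicator W x := fun x =>
    Set.indicator_le_indicator_of_subset (pairNear_subset_pairIn hL) (fun _ => zero_le) x
  set wG := (pairIn j k (planeSquare a b L)).indicator W with hwG
  set wB := (pairNear j k !₂[a + L / 2, b + L / 2] (L ^ 2 / 4)).indicator W with hwB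
  set f : (Fin n → Plane) → ℝ := fun x => ‖ψ x‖ ^ 2 with hf
  set E : (Fin n → Plane) → ℝ := fun x => anyonEnergy α ψ j x + anyonEnergy α ψ k x with hE
  have hwG1 : ∀ x, wG x ≤ 1 := fun x => (Set.indicator_le_self _ _ _).trans (hW1 x)
  have hfin : ∀ g : (Fin n → Plane) → ℝ, Continuous g → HasCompactSupport g →
      ∫⁻ x, wG x * ENNReal.ofReal (g x) ≠ ⊤ := by
    intro g hg hgs
    refine ne_top_of_le_ne_top (hg.integrable_of_hasCompactSupport hgs).lintegral_lt_top.ne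
      (lintegral_mono fun x => ?_)
    exact (mul_le_mul' (hwG1 x) le_rfl).trans_eq (one_mul _)
  have hA : ∫⁻ x, wG x * ENNReal.ofReal (f x) ≠ ⊤ :=
    hfin f (hψ.continuous.norm.pow 2) (hcs.norm.comp_left (g := fun r : ℝ => r ^ 2) (by norm_num))
  have hEt : ∫⁻ x, wG x * ENNReal.ofReal (E x) ≠ ⊤ :=
    hfin E ((continuous_anyonEnergy hψ hsupp j).add (continuous_anyonEnergy hψ hsupp k))
      ((hasCompactSupport_anyonEnergy hcs j).add (hasCompactSupport_anyonEnergy hcs k))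
  have hB : ∫⁻ x, wB x * ENNReal.ofReal (f x) ≠ ⊤ :=
    ne_top_of_le_ne_top hA (lintegral_mono fun x => mul_le_mul' (hmono x) le_rfl)
  have hBE : ∫⁻ x, wB x * ENNReal.ofReal (E x) ≤ ∫⁻ x, wG x * ENNReal.ofReal (E x) :=
    lintegral_mono fun x => mul_le_mul' (hmono x) le_rfl
  replace h2 := h2.trans (mul_le_mul' le_rfl hBE)
  obtain ⟨A, hA0, hAe⟩ : ∃ A : ℝ, 0 ≤ A ∧ ∫⁻ x, wG x * ENNReal.ofReal (f x) = ENNReal.ofReal A :=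
    ⟨_, ENNReal.toReal_nonneg, (ENNReal.ofReal_toReal hA).symm⟩
  obtain ⟨B, hB0, hBe⟩ : ∃ A : ℝ, 0 ≤ A ∧ ∫⁻ x, wB x * ENNReal.ofReal (f x) = ENNReal.ofReal A :=
    ⟨_, ENNReal.toReal_nonneg, (ENNReal.ofReal_toReal hB).symm⟩
  obtain ⟨T, hT0, hTe⟩ : ∃ A : ℝ, 0 ≤ A ∧ ∫⁻ x, wG x * ENNReal.ofReal (E x) = ENNReal.ofReal A :=
    ⟨_, ENNReal.toReal_nonneg, (ENNReal.ofReal_toReal hEt).symm⟩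
  rw [hAe, hBe, hTe] at h1
  rw [hBe, hTe] at h2
  rw [hAe, hTe]
  have h16 : (16 : ENNReal) = ENNReal.ofReal 16 := by simp
  rw [h16, ← ENNReal.ofReal_mul (by positivity), ← ENNReal.ofReal_mul (by positivity),
    ← ENNReal.ofReal_mul (by positivity), ← ENNReal.ofReal_add (by positivity) (by positivity),
    ← ENNReal.ofReal_mul (by positivity), ← ENNReal.ofReal_add (by positivity) (by positivity),
    ENNReal.ofReal_le_ofReal_iff (by positivity)] at h1
  rw [← ENNReal.ofReal_mul (by positivity), ← ENNReal.ofReal_mul (by positivity),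
    ENNReal.ofReal_le_ofReal_iff (by positivity)] at h2 ⊢
  have hC1 : Calpha α n ^ 2 ≤ 1 := pow_le_one₀ (Calpha_nonneg α n) (Calpha_le_one α n)
  have hC0 : 0 ≤ Calpha α n ^ 2 := sq_nonneg _
  have hLT : 0 ≤ L ^ 2 * T := by positivity
  have h3 := mul_le_mul_of_nonneg_left h1 hC0
  have h4 := mul_le_mul_of_nonneg_right hC1 hLT
  norm_num at h3
  nlinarith

end Exclusion

section Symmetry

variable {α : ℝ} {n : ℕ} {ψ : (Fin n → Plane) → ℂ}

lemma anyonA_comp_perm (σ : Equiv.Perm (Fin n)) (x : Fin n → Plane) (j : Fin n) (i : Fin 2) :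
    anyonA α (x ∘ σ) j i = anyonA α x (σ j) i := by
  unfold anyonA
  congr 1
  refine Finset.sum_equiv σ (fun k => ?_) fun k _ => rfl
  simp

lemma fderiv_comp_perm (hψ : ContDiff ℝ (⊤ : ℕ∞) ψ)
    (hsym : ∀ (σ : Equiv.Perm (Fin n)) (x : Fin n → Plane), ψ (x ∘ σ) = ψ x)
    (σ : Equiv.Perm (Fin n)) (x u : Fin n → Plane) :
    fderiv ℝ ψ x u = fderiv ℝ ψ (x ∘ σ) (u ∘ σ) := by
  set P : (Fin n → Plane) →L[ℝ] (Fin n → Plane) :=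
    ContinuousLinearMap.pi fun l => ContinuousLinearMap.proj (σ l) with hP
  have h1 : ψ ∘ P = ψ := funext fun y => hsym σ y
  have h2 : HasFDerivAt (ψ ∘ P) ((fderiv ℝ ψ (P x)).comp P) x :=
    HasFDerivAt.comp x ((hψ.differentiable (by simp)) (P x)).hasFDerivAt P.hasFDerivAt
  rw [h1] at h2
  rw [h2.fderiv]
  rfl

lemma anyonD_comp_perm (hψ : ContDiff ℝ (⊤ : ℕ∞) ψ)
    (hsym : ∀ (σ : Equiv.Perm (Fin n)) (x : Fin n → Plane), ψ (x ∘ σ) = ψ x)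
    (σ : Equiv.Perm (Fin n)) (x : Fin n → Plane) (j : Fin n) (i : Fin 2) :
    anyonD α ψ (x ∘ σ) j i = anyonD α ψ x (σ j) i := by
  unfold anyonD
  rw [anyonA_comp_perm, hsym, fderiv_comp_perm hψ hsym σ x]
  congr 3
  funext l
  by_cases h : l = j
  · subst h; simp
  · have : σ l ≠ σ j := fun h' => h (σ.injective h')
    simp [h, this]

lemma anyonEnergy_comp_perm (hψ : ContDiff ℝ (⊤ : ℕ∞) ψ)
    (hsym : ∀ (σ : Equiv.Perm (Fin n)) (x : Fin n → Plane), ψ (x ∘ σ) = ψ x)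
    (σ : Equiv.Perm (Fin n)) (x : Fin n → Plane) (j : Fin n) :
    anyonEnergy α ψ j (x ∘ σ) = anyonEnergy α ψ (σ j) x := by
  simp only [anyonEnergy, anyonD_comp_perm hψ hsym]

lemma coe_piCongrLeft_perm_symm (σ : Equiv.Perm (Fin n)) :
    (MeasurableEquiv.piCongrLeft (fun _ : Fin n => Plane) σ.symm : _ → _)
      = fun x : Fin n → Plane => x ∘ σ := by
  funext x l
  obtain ⟨l, rfl⟩ := σ.symm.surjective l
  simp [MeasurableEquiv.coe_piCongrLeft, Equiv.piCongrLeft_apply_apply]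

lemma measurePreserving_comp_perm (σ : Equiv.Perm (Fin n)) :
    MeasurePreserving fun x : Fin n → Plane => x ∘ σ := by
  rw [← coe_piCongrLeft_perm_symm]
  exact volume_measurePreserving_piCongrLeft (fun _ : Fin n => Plane) σ.symm

/-- By symmetry, the integrals of a one-particle quantity do not depend on the particle. -/
lemma lintegral_one_particle_eq {g : Fin n → (Fin n → Plane) → ℝ} (hg : ∀ j, Continuous (g j))
    (hgsym : ∀ (σ : Equiv.Perm (Fin n)) x j, g j (x ∘ σ) = g (σ j) x)
    {Q : Set Plane} (hQ : MeasurableSet Q) (j k : Fin n) :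
    ∫⁻ x, Q.indicator 1 (x j) * ENNReal.ofReal (g j x)
      = ∫⁻ x, Q.indicator 1 (x k) * ENNReal.ofReal (g k x) := by
  have hm : Measurable fun x : Fin n → Plane =>
      Q.indicator (1 : Plane → ENNReal) (x k) * ENNReal.ofReal (g k x) :=
    ((measurable_one.indicator hQ).comp (measurable_pi_apply k)).mul
      (hg k).measurable.ennreal_ofReal
  have h := (measurePreserving_comp_perm (Equiv.swap j k)).lintegral_comp hm
  simp only [hgsym, Function.comp_apply, Equiv.swap_apply_right] at h
  exact h

end Symmetry

section Counting

variable {n : ℕ}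

open Classical in
/-- The weight attached to a pair of particles in `Q`: the inverse of the number of other
particles in `Q`, plus one. -/
noncomputable def pairWeight (j k : Fin n) (Q : Set Plane) (x : Fin n → Plane) : ENNReal :=
  (((Finset.univ.filter fun l => (l ≠ j ∧ l ≠ k) ∧ x l ∈ Q).card + 1 : ℕ) : ENNReal)⁻¹

lemma measurable_pairWeight (j k : Fin n) {Q : Set Plane} (hQ : MeasurableSet Q) :
    Measurable (pairWeight j k Q) := by
  classical
  have : pairWeight j k Q = fun x : Fin n → Plane =>
      (((∑ l, if (l ≠ j ∧ l ≠ k) ∧ x l ∈ Q then 1 else 0) + 1 : ℕ) : ENNReal)⁻¹ := by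
    funext x
    rw [pairWeight, Finset.card_filter]
  rw [this]
  refine Measurable.inv ((measurable_from_nat (f := fun m : ℕ => (m : ENNReal))).comp ?_)
  refine Measurable.add_const (Finset.measurable_sum _ fun l _ => ?_) 1
  refine Measurable.ite ?_ measurable_const measurable_const
  exact (MeasurableSet.const _).inter (measurable_pi_apply l hQ)

lemma pairWeight_le_one (j k : Fin n) (Q : Set Plane) (x : Fin n → Plane) :
    pairWeight j k Q x ≤ 1 := by
  rw [pairWeight, ENNReal.inv_le_one]
  exact_mod_cast Nat.le_add_left 1 _

lemma pairWeight_congr {j k : Fin n} {Q : Set Plane} (x y : Fin n → Plane)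
    (h : ∀ l, l ≠ j → l ≠ k → x l = y l) : pairWeight j k Q x = pairWeight j k Q y := by
  classical
  unfold pairWeight
  congr 4
  ext l
  simp only [Finset.mem_filter, Finset.mem_univ, true_and, and_congr_right_iff]
  rintro ⟨h1, h2⟩
  rw [h l h1 h2]

lemma pairWeight_comm (j k : Fin n) (Q : Set Plane) (x : Fin n → Plane) :
    pairWeight j k Q x = pairWeight k j Q x := by
  unfold pairWeight
  congr 4
  ext l
  simp only [Finset.mem_filter, Finset.mem_univ, true_and]
  tauto

lemma pairWeight_eq {j k : Fin n} (hjk : j ≠ k) {Q : Set Plane} {x : Fin n → Plane}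
    (hx : x ∈ pairIn j k Q) [DecidablePred fun l => x l ∈ Q] :
    pairWeight j k Q x = (((Finset.univ.filter fun l => x l ∈ Q).card - 1 : ℕ) : ENNReal)⁻¹ := by
  classical
  rw [pairWeight]
  congr 2
  have h : (Finset.univ.filter fun l => x l ∈ Q)
      = insert j (insert k (Finset.univ.filter fun l => (l ≠ j ∧ l ≠ k) ∧ x l ∈ Q)) := by
    ext l
    simp only [Finset.mem_filter, Finset.mem_univ, true_and, Finset.mem_insert]
    constructor
    · intro hl
      by_cases h1 : l = j
      · exact Or.inl h1
      by_cases h2 : l = k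
      · exact Or.inr (Or.inl h2)
      exact Or.inr (Or.inr ⟨⟨h1, h2⟩, hl⟩)
    · rintro (rfl | rfl | h)
      · exact hx.1
      · exact hx.2
      · exact h.2
  rw [h, Finset.card_insert_of_notMem (by simp [hjk]), Finset.card_insert_of_notMem (by simp),
    Nat.add_sub_cancel]
  congr!

open Classical in
lemma sum_indicator_pairWeight (j : Fin n) (Q : Set Plane) (x : Fin n → Plane) :
    ∑ k ∈ Finset.univ.filter (fun k => k ≠ j), (pairIn j k Q).indicator (pairWeight j k Q) x
      = Q.indicator 1 (x j) * ((((Finset.univ.filter fun l => x l ∈ Q).card - 1 : ℕ) : ENNReal)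
        * (((Finset.univ.filter fun l => x l ∈ Q).card - 1 : ℕ) : ENNReal)⁻¹) := by
  by_cases hj : x j ∈ Q
  · rw [Set.indicator_of_mem hj, Pi.one_apply, one_mul]
    have h : ∀ k ∈ Finset.univ.filter (fun k => k ≠ j),
        (pairIn j k Q).indicator (pairWeight j k Q) x = if x k ∈ Q then
          (((Finset.univ.filter fun l => x l ∈ Q).card - 1 : ℕ) : ENNReal)⁻¹ else 0 := by
      intro k hk
      simp only [Finset.mem_filter, Finset.mem_univ, true_and] at hk
      split_ifs with hkQ
      · have : x ∈ pairIn j k Q := ⟨hj, hkQ⟩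
        rw [Set.indicator_of_mem this, pairWeight_eq hk.symm this]
      · exact Set.indicator_of_notMem (fun h => hkQ h.2) _
    rw [Finset.sum_congr rfl h, ← Finset.sum_filter, Finset.sum_const, nsmul_eq_mul]
    congr 2
    have h2 : (Finset.univ.filter (fun k => k ≠ j)).filter (fun k => x k ∈ Q)
        = (Finset.univ.filter fun l => x l ∈ Q).erase j := by
      ext l; simp
    rw [h2, Finset.card_erase_of_mem (by simpa using hj)]
  · rw [Set.indicator_of_notMem hj, zero_mul]
    exact Finset.sum_eq_zero fun k _ => Set.indicator_of_notMem (fun h => hj h.1) _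

lemma sum_indicator_pairWeight_le (j : Fin n) (Q : Set Plane) (x : Fin n → Plane) :
    ∑ k ∈ Finset.univ.filter (fun k => k ≠ j), (pairIn j k Q).indicator (pairWeight j k Q) x
      ≤ Q.indicator 1 (x j) := by
  classical
  rw [sum_indicator_pairWeight]
  exact (mul_le_mul' le_rfl (ENNReal.mul_inv_le_one _)).trans_eq (mul_one _)

lemma sum_indicator_le_pairWeight (Q : Set Plane) (x : Fin n → Plane) :
    ∑ j, Q.indicator (1 : Plane → ENNReal) (x j)
      ≤ 1 + ∑ j, ∑ k ∈ Finset.univ.filter (fun k => k ≠ j),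
        (pairIn j k Q).indicator (pairWeight j k Q) x := by
  classical
  simp only [sum_indicator_pairWeight, ← Finset.sum_mul]
  have h : ∑ j, Q.indicator (1 : Plane → ENNReal) (x j)
      = ((Finset.univ.filter fun l => x l ∈ Q).card : ENNReal) := by
    rw [Finset.card_filter]
    push_cast
    exact Finset.sum_congr rfl fun l _ => by simp [Set.indicator_apply]
  rw [h]
  generalize (Finset.univ.filter fun l => x l ∈ Q).card = m
  rcases Nat.lt_or_ge m 2 with hm | hm
  · interval_cases m <;> simp
  · rw [ENNReal.mul_inv_cancel]
    · simp
    · have : m - 1 ≠ 0 := by omega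
      exact_mod_cast this
    · exact ENNReal.natCast_ne_top _

end Counting

section LocalExclusion

variable {α : ℝ} {n : ℕ} {ψ : (Fin n → Plane) → ℂ}

lemma indicator_pairWeight_comm (j k : Fin n) (Q : Set Plane) (x : Fin n → Plane) :
    (pairIn j k Q).indicator (pairWeight j k Q) x
      = (pairIn k j Q).indicator (pairWeight k j Q) x := by
  have h : pairIn j k Q = pairIn k j Q := by
    ext y; exact and_comm
  rw [h, funext (pairWeight_comm j k Q)]

lemma measurable_indicator_pairWeight (j k : Fin n) {Q : Set Plane} (hQ : MeasurableSet Q) :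
    Measurable ((pairIn j k Q).indicator (pairWeight j k Q)) :=
  (measurable_pairWeight j k hQ).indicator (measurableSet_pairIn j k hQ)

/-- Summing the weighted pair energies over all pairs costs at most twice the local energy. -/
lemma sum_lintegral_pairWeight_le {Q : Set Plane} (hQ : MeasurableSet Q)
    {E : Fin n → (Fin n → Plane) → ENNReal} (hE : ∀ j, Measurable (E j)) :
    ∑ j, ∑ k ∈ Finset.univ.filter (fun k => k ≠ j),
        ∫⁻ x, (pairIn j k Q).indicator (pairWeight j k Q) x * (E j x + E k x)
      ≤ 2 * ∑ j, ∫⁻ x, Q.indicator 1 (x j) * E j x := by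
  have hG := fun j k => measurable_indicator_pairWeight (n := n) j k hQ
  have h1 : ∀ j k, ∫⁻ x, (pairIn j k Q).indicator (pairWeight j k Q) x * (E j x + E k x)
      = (∫⁻ x, (pairIn j k Q).indicator (pairWeight j k Q) x * E j x)
        + ∫⁻ x, (pairIn k j Q).indicator (pairWeight k j Q) x * E k x := by
    intro j k
    simp_rw [mul_add]
    rw [lintegral_add_left ((hG j k).fun_mul (hE j))]
    simp_rw [indicator_pairWeight_comm j k]
  have h2 : ∑ j, ∑ k ∈ Finset.univ.filter (fun k => k ≠ j),
      ∫⁻ x, (pairIn j k Q).indicator (pairWeight j k Q) x * E j x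
        ≤ ∑ j, ∫⁻ x, Q.indicator 1 (x j) * E j x := by
    refine Finset.sum_le_sum fun j _ => ?_
    rw [← lintegral_finsetSum _ fun k _ => (hG j k).fun_mul (hE j)]
    refine lintegral_mono fun x => ?_
    simp only []
    rw [← Finset.sum_mul]
    exact mul_le_mul' (sum_indicator_pairWeight_le j Q x) le_rfl
  have h3 : ∑ j, ∑ k ∈ Finset.univ.filter (fun k => k ≠ j),
      ∫⁻ x, (pairIn k j Q).indicator (pairWeight k j Q) x * E k x
      = ∑ j, ∑ k ∈ Finset.univ.filter (fun k => k ≠ j),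
      ∫⁻ x, (pairIn j k Q).indicator (pairWeight j k Q) x * E j x := by
    refine Finset.sum_comm' fun j k => ?_
    simp only [Finset.mem_filter, Finset.mem_univ, true_and, and_true]
    exact ne_comm
  simp_rw [h1, Finset.sum_add_distrib]
  rw [h3, two_mul]
  exact add_le_add h2 h2

lemma local_exclusion_lintegral (hψ : ContDiff ℝ (⊤ : ℕ∞) ψ) (hcs : HasCompactSupport ψ)
    (hsym : ∀ (σ : Equiv.Perm (Fin n)) (x : Fin n → Plane), ψ (x ∘ σ) = ψ x)
    (hsupp : ∀ x ∈ tsupport ψ, ∀ j k : Fin n, j ≠ k → x j ≠ x k)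
    {a b L : ℝ} (hL : 0 < L) :
    ENNReal.ofReal (Calpha α n ^ 2) *
        ∑ j, ∫⁻ x, (planeSquare a b L).indicator 1 (x j) * ENNReal.ofReal (‖ψ x‖ ^ 2)
      ≤ ENNReal.ofReal (Calpha α n ^ 2) * (∫⁻ x, ENNReal.ofReal (‖ψ x‖ ^ 2))
        + ENNReal.ofReal (60 * L ^ 2) * ∑ j, ∫⁻ x, (planeSquare a b L).indicator 1 (x j) *
            ENNReal.ofReal (anyonEnergy α ψ j x) := by
  set Q := planeSquare a b L with hQdef
  have hQ : MeasurableSet Q := measurableSet_planeSquare a b L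
  have hG := fun j k => measurable_indicator_pairWeight (n := n) j k hQ
  have hf : Measurable fun x => ENNReal.ofReal (‖ψ x‖ ^ 2) :=
    (hψ.continuous.norm.fun_pow 2).measurable.ennreal_ofReal
  have hE : ∀ j, Measurable fun x => ENNReal.ofReal (anyonEnergy α ψ j x) := fun j =>
    (continuous_anyonEnergy hψ hsupp j).measurable.ennreal_ofReal
  have hI : ∀ j : Fin n, Measurable fun x : Fin n → Plane =>
      Q.indicator (1 : Plane → ENNReal) (x j) := fun j =>
    (measurable_one.indicator hQ).comp (measurable_pi_apply j)
  have h1 : ∑ j, ∫⁻ x, Q.indicator 1 (x j) * ENNReal.ofReal (‖ψ x‖ ^ 2)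
      ≤ (∫⁻ x, ENNReal.ofReal (‖ψ x‖ ^ 2)) + ∑ j, ∑ k ∈ Finset.univ.filter (fun k => k ≠ j),
        ∫⁻ x, (pairIn j k Q).indicator (pairWeight j k Q) x * ENNReal.ofReal (‖ψ x‖ ^ 2) := by
    rw [← lintegral_finsetSum _ fun j _ => (hI j).fun_mul hf]
    simp_rw [← lintegral_finsetSum _ fun k _ => (hG _ k).fun_mul hf]
    rw [← lintegral_finsetSum _ fun j _ => Finset.measurable_fun_sum _ fun k _ => (hG j k).fun_mul hf,
      ← lintegral_add_left hf]
    refine lintegral_mono fun x => ?_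
    simp only [← Finset.sum_mul]
    refine (mul_le_mul' (sum_indicator_le_pairWeight Q x) le_rfl).trans_eq ?_
    rw [add_mul, one_mul]
  refine (mul_le_mul' le_rfl h1).trans ?_
  rw [mul_add]
  refine add_le_add le_rfl ?_
  rw [Finset.mul_sum]
  simp_rw [Finset.mul_sum (Finset.univ.filter _)]
  have h2 : ∑ j, ∑ k ∈ Finset.univ.filter (fun k => k ≠ j), ENNReal.ofReal (Calpha α n ^ 2) *
        (∫⁻ x, (pairIn j k Q).indicator (pairWeight j k Q) x * ENNReal.ofReal (‖ψ x‖ ^ 2))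
      ≤ ∑ j, ∑ k ∈ Finset.univ.filter (fun k => k ≠ j), ENNReal.ofReal (30 * L ^ 2) *
        ∫⁻ x, (pairIn j k Q).indicator (pairWeight j k Q) x *
          (ENNReal.ofReal (anyonEnergy α ψ j x) + ENNReal.ofReal (anyonEnergy α ψ k x)) := by
    refine Finset.sum_le_sum fun j _ => Finset.sum_le_sum fun k hk => ?_
    have hk' : j ≠ k := (Finset.mem_filter.mp hk).2.symm
    have h3 := pair_exclusion (α := α) hψ hcs hsym hsupp hk' (a := a) (b := b) hL
      (measurable_pairWeight j k hQ) (pairWeight_le_one j k Q) pairWeight_congr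
    simp_rw [ENNReal.ofReal_add (anyonEnergy_nonneg α ψ _ _) (anyonEnergy_nonneg α ψ _ _)] at h3
    exact h3
  refine h2.trans ?_
  simp_rw [← Finset.mul_sum]
  refine (mul_le_mul' le_rfl (sum_lintegral_pairWeight_le hQ hE)).trans_eq ?_
  rw [← mul_assoc]
  congr 1
  rw [show (2 : ENNReal) = ENNReal.ofReal 2 by simp, ← ENNReal.ofReal_mul (by positivity)]
  congr 1
  ring

/-- The local exclusion principle: the local kinetic energy on a square is bounded below by the
expected number of particles in excess of one. -/
lemma local_exclusion (hψ : ContDiff ℝ (⊤ : ℕ∞) ψ) (hcs : HasCompactSupport ψ)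
    (hsym : ∀ (σ : Equiv.Perm (Fin n)) (x : Fin n → Plane), ψ (x ∘ σ) = ψ x)
    (hsupp : ∀ x ∈ tsupport ψ, ∀ j k : Fin n, j ≠ k → x j ≠ x k)
    (hnorm : ∫ x, ‖ψ x‖ ^ 2 = 1) (j : Fin n) {a b L : ℝ} (hL : 0 < L) :
    Calpha α n ^ 2 * (n * (∫ x in {x | x j ∈ planeSquare a b L}, ‖ψ x‖ ^ 2) - 1)
      ≤ 60 * L ^ 2 * (n * ∫ x in {x | x j ∈ planeSquare a b L}, anyonEnergy α ψ j x) := by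
  have h := local_exclusion_lintegral (α := α) hψ hcs hsym hsupp (a := a) (b := b) hL
  set Q := planeSquare a b L with hQdef
  have hQ : MeasurableSet Q := measurableSet_planeSquare a b L
  have hS : MeasurableSet {x : Fin n → Plane | x j ∈ Q} := measurable_pi_apply j hQ
  have hconv : ∀ g : (Fin n → Plane) → ℝ, Continuous g → HasCompactSupport g → (∀ x, 0 ≤ g x) →
      ∫⁻ x, Q.indicator 1 (x j) * ENNReal.ofReal (g x)
        = ENNReal.ofReal (∫ x in {x | x j ∈ Q}, g x) := by
    intro g hg hgc hg0
    rw [ofReal_integral_eq_lintegral_ofReal (hg.integrable_of_hasCompactSupport hgc).integrableOn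
      (ae_of_all _ hg0), ← lintegral_indicator hS]
    refine lintegral_congr fun x => ?_
    by_cases hx : x j ∈ Q
    · rw [Set.indicator_of_mem hx, Set.indicator_of_mem (by exact hx)]; simp
    · rw [Set.indicator_of_notMem hx, Set.indicator_of_notMem (by exact hx)]; simp
  have hfc : HasCompactSupport fun x => ‖ψ x‖ ^ 2 := by
    refine HasCompactSupport.intro hcs fun x hx => ?_
    simp [image_eq_zero_of_notMem_tsupport hx]
  have hfi := (hψ.continuous.norm.fun_pow 2).integrable_of_hasCompactSupport (μ := volume) hfc
  have hs1 : ∀ k ∈ Finset.univ,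
      ∫⁻ x, Q.indicator 1 (x k) * ENNReal.ofReal (‖ψ x‖ ^ 2)
        = ENNReal.ofReal (∫ x in {x | x j ∈ Q}, ‖ψ x‖ ^ 2) := fun k _ => by
    rw [← hconv _ (hψ.continuous.norm.fun_pow 2) hfc fun x => by positivity]
    exact lintegral_one_particle_eq (g := fun _ x => ‖ψ x‖ ^ 2)
      (fun _ => hψ.continuous.norm.fun_pow 2) (fun σ x _ => by rw [hsym]) hQ k j
  have hs2 : ∀ k ∈ Finset.univ,
      ∫⁻ x, Q.indicator 1 (x k) * ENNReal.ofReal (anyonEnergy α ψ k x)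
        = ENNReal.ofReal (∫ x in {x | x j ∈ Q}, anyonEnergy α ψ j x) := fun k _ => by
    rw [← hconv _ (continuous_anyonEnergy hψ hsupp j) (hasCompactSupport_anyonEnergy hcs j)
      (anyonEnergy_nonneg α ψ j)]
    exact lintegral_one_particle_eq (g := anyonEnergy α ψ)
      (fun k => continuous_anyonEnergy hψ hsupp k)
      (fun σ x k => anyonEnergy_comp_perm hψ hsym σ x k) hQ k j
  have hm : 0 ≤ ∫ x in {x | x j ∈ Q}, ‖ψ x‖ ^ 2 :=
    integral_nonneg fun x => by positivity
  have hT : 0 ≤ ∫ x in {x | x j ∈ Q}, anyonEnergy α ψ j x :=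
    integral_nonneg fun x => anyonEnergy_nonneg α ψ j x
  rw [Finset.sum_congr rfl hs1, Finset.sum_congr rfl hs2,
    ← ofReal_integral_eq_lintegral_ofReal hfi (ae_of_all _ fun x => by positivity), hnorm,
    Finset.sum_const, Finset.sum_const, Finset.card_univ, Fintype.card_fin,
    ← ENNReal.ofReal_nsmul, ← ENNReal.ofReal_nsmul, nsmul_eq_mul, nsmul_eq_mul,
    ← ENNReal.ofReal_mul (by positivity), ← ENNReal.ofReal_mul (by positivity),
    ← ENNReal.ofReal_mul (by positivity), ← ENNReal.ofReal_add (by positivity) (by positivity),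
    ENNReal.ofReal_le_ofReal_iff (by positivity)] at h
  linarith

end LocalExclusion

section Covering

/-- A square function which is additive under the subdivision into four congruent squares. -/
def QuadAdditive (m : ℝ → ℝ → ℝ → ℝ) : Prop :=
  ∀ a b L, 0 < L → m a b (L + L)
    = m a b L + m (a + L) b L + m a (b + L) L + m (a + L) (b + L) L

/-- A local uncertainty principle and a local exclusion principle on all squares combine, through
repeated subdivision, to a bound on every square containing enough mass. -/
lemma covering_bound {m T R : ℝ → ℝ → ℝ → ℝ} {c M : ℝ} (hc0 : 0 ≤ c) (hc1 : c ≤ 1)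
    (hm : QuadAdditive m) (hT : QuadAdditive T) (hR : QuadAdditive R)
    (hm0 : ∀ a b L, 0 ≤ m a b L) (hT0 : ∀ a b L, 0 ≤ T a b L)
    (hM : ∀ a b L, 0 < L → m a b L ≤ M * L ^ 2)
    (hU : ∀ a b L, 0 < L → R a b L ≤ 10 * (m a b L * T a b L) + 5 / 4 * (m a b L / L) ^ 2)
    (hX : ∀ a b L, 0 < L → c * (m a b L - 1) ≤ 60 * L ^ 2 * T a b L)
    {a b L : ℝ} (hL : 0 < L) (hmass : 2 ≤ m a b L) :
    c * R a b L / 5000 + c * (1 / L ^ 2) / 250 ≤ T a b L := by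
  have hsmall : ∀ a b L, 0 < L → m a b L < 2 →
      c * R a b L / 5000 - c * (1 / L ^ 2) / 1000 ≤ T a b L := by
    intro a b L hL hlt
    have hu := mul_le_mul_of_nonneg_left (hU a b L hL) hc0
    have h1 : m a b L * T a b L ≤ 2 * T a b L :=
      mul_le_mul_of_nonneg_right hlt.le (hT0 a b L)
    have h2 : (m a b L / L) ^ 2 ≤ 4 * (1 / L ^ 2) := by
      rw [div_pow, div_eq_mul_one_div]
      gcongr
      nlinarith [hm0 a b L]
    have h3 := mul_le_mul_of_nonneg_right hc1 (hT0 a b L)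
    have h4 := mul_le_mul_of_nonneg_left h1 hc0
    have h5 := mul_le_mul_of_nonneg_left h2 hc0
    have h6 := hT0 a b L
    linarith
  have hleaf : ∀ a b L, 0 < L → 2 ≤ m a b L → m a b L < 8 →
      c * R a b L / 5000 + c * (1 / L ^ 2) / 250 ≤ T a b L := by
    intro a b L hL h2m hlt
    have hu := mul_le_mul_of_nonneg_left (hU a b L hL) hc0
    have hx : c * (m a b L - 1) * (1 / L ^ 2) ≤ 60 * T a b L := by
      have := mul_le_mul_of_nonneg_right (hX a b L hL) (by positivity : 0 ≤ 1 / L ^ 2)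
      have e : 60 * L ^ 2 * T a b L * (1 / L ^ 2) = 60 * T a b L := by field_simp
      linarith
    have h1 : m a b L * T a b L ≤ 8 * T a b L :=
      mul_le_mul_of_nonneg_right hlt.le (hT0 a b L)
    have h2 : (m a b L / L) ^ 2 ≤ 10 * (m a b L - 1) * (1 / L ^ 2) := by
      rw [div_pow, div_eq_mul_one_div]
      gcongr
      nlinarith [hm0 a b L]
    have h3 := mul_le_mul_of_nonneg_right hc1 (hT0 a b L)
    have h4 := mul_le_mul_of_nonneg_left h1 hc0
    have h5 := mul_le_mul_of_nonneg_left h2 hc0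
    have h6 := hT0 a b L
    have h7 : c * (1 / L ^ 2) ≤ c * (m a b L - 1) * (1 / L ^ 2) := by
      gcongr
      nlinarith
    linarith
  have hind : ∀ k : ℕ, ∀ a b L, 0 < L → M * L ^ 2 < 8 * 4 ^ k → 2 ≤ m a b L →
      c * R a b L / 5000 + c * (1 / L ^ 2) / 250 ≤ T a b L := by
    intro k
    induction k with
    | zero =>
      intro a b L hL hML h2m
      exact hleaf a b L hL h2m ((hM a b L hL).trans_lt (by simpa using hML))
    | succ k ih =>
      intro a b L hL hML h2m
      rcases lt_or_ge (m a b L) 8 with hlt | hge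
      · exact hleaf a b L hL h2m hlt
      obtain ⟨l, rfl⟩ : ∃ l, L = l + l := ⟨L / 2, by ring⟩
      have hl : 0 < l := by linarith
      have hMl : M * l ^ 2 < 8 * 4 ^ k := by
        have h4 : (4 : ℝ) ^ (k + 1) = 4 * 4 ^ k := by ring
        rw [h4] at hML
        nlinarith
      have hchild : ∀ a b, c * R a b l / 5000 - c * (1 / l ^ 2) / 1000 ≤ T a b l := by
        intro a b
        rcases lt_or_ge (m a b l) 2 with h | h
        · exact hsmall a b l hl h
        · have := ih a b l hl hMl h
          have h0 : 0 ≤ c * (1 / l ^ 2) := by positivity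
          linarith
      have hquarter : c * (1 / (l + l) ^ 2) = c * (1 / l ^ 2) / 4 := by
        field_simp
        ring
      rw [hm a b l hl] at hge
      rw [hT a b l hl, hR a b l hl, hquarter]
      have h1 := hchild a b
      have h2 := hchild (a + l) b
      have h3 := hchild a (b + l)
      have h4 := hchild (a + l) (b + l)
      by_cases g1 : 2 ≤ m a b l
      · have := ih a b l hl hMl g1
        linarith
      by_cases g2 : 2 ≤ m (a + l) b l
      · have := ih _ _ l hl hMl g2
        linarith
      by_cases g3 : 2 ≤ m a (b + l) l
      · have := ih _ _ l hl hMl g3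
        linarith
      have g4 : 2 ≤ m (a + l) (b + l) l := by linarith
      have := ih _ _ l hl hMl g4
      linarith
  obtain ⟨k, hk⟩ := pow_unbounded_of_one_lt (M * L ^ 2 / 8) (by norm_num : (1 : ℝ) < 4)
  exact hind k a b L hL (by linarith) hmass

lemma planeSquare_quadruple (a b : ℝ) {L : ℝ} (hL : 0 < L) :
    planeSquare a b (L + L) = ((planeSquare a b L ∪ planeSquare (a + L) b L)
      ∪ planeSquare a (b + L) L) ∪ planeSquare (a + L) (b + L) L := by
  ext y
  simp only [planeSquare, Set.mem_union, Set.mem_ofPred_eq, Set.mem_Ico]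
  constructor
  · rintro ⟨⟨h1, h2⟩, h3, h4⟩
    rcases lt_or_ge (y 0) (a + L) with h | h <;> rcases lt_or_ge (y 1) (b + L) with h' | h'
    · exact Or.inl (Or.inl (Or.inl ⟨⟨h1, h⟩, h3, h'⟩))
    · exact Or.inl (Or.inr ⟨⟨h1, h⟩, h', by linarith⟩)
    · exact Or.inl (Or.inl (Or.inr ⟨⟨h, by linarith⟩, h3, h'⟩))
    · exact Or.inr ⟨⟨h, by linarith⟩, h', by linarith⟩
  · rintro (((⟨⟨h1, h2⟩, h3, h4⟩ | ⟨⟨h1, h2⟩, h3, h4⟩) | ⟨⟨h1, h2⟩, h3, h4⟩) |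
      ⟨⟨h1, h2⟩, h3, h4⟩) <;>
    exact ⟨⟨by linarith, by linarith⟩, by linarith, by linarith⟩

lemma quadAdditive_setIntegral {g : Plane → ℝ} (hg : Integrable g) :
    QuadAdditive fun a b L => ∫ y in planeSquare a b L, g y := by
  intro a b L hL
  simp only []
  have hms := measurableSet_planeSquare
  rw [planeSquare_quadruple a b hL, setIntegral_union ?_ (hms _ _ _) hg.integrableOn
    hg.integrableOn, setIntegral_union ?_ (hms _ _ _) hg.integrableOn
    hg.integrableOn, setIntegral_union ?_ (hms _ _ _) hg.integrableOn hg.integrableOn]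
  all_goals
    rw [Set.disjoint_left]
    simp only [planeSquare, Set.mem_union, Set.mem_ofPred_eq, Set.mem_Ico]
  · rintro y ⟨⟨h1, h2⟩, h3, h4⟩ ⟨⟨h5, h6⟩, h7, h8⟩
    linarith
  · rintro y (⟨⟨h1, h2⟩, h3, h4⟩ | ⟨⟨h1, h2⟩, h3, h4⟩) ⟨⟨h5, h6⟩, h7, h8⟩ <;> linarith
  · rintro y ((⟨⟨h1, h2⟩, h3, h4⟩ | ⟨⟨h1, h2⟩, h3, h4⟩) | ⟨⟨h1, h2⟩, h3, h4⟩)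
      ⟨⟨h5, h6⟩, h7, h8⟩ <;> linarith

end Covering

section Marginal

lemma HasCompactSupport.comp_of_leftInverse {A B : Type*} [TopologicalSpace A] [R1Space A]
    [TopologicalSpace B] {g : B → ℝ} (hg : HasCompactSupport g) {F : A → B} {r : B → A}
    (hr : Continuous r) (h : Function.LeftInverse r F) : HasCompactSupport fun a => g (F a) := by
  refine HasCompactSupport.intro (hg.image hr) fun a ha => ?_
  refine image_eq_zero_of_notMem_tsupport fun h' => ha ⟨F a, h', h a⟩

variable {n : ℕ}

/-- The configuration with particle `j` at `y` and the other particles given by `z`. -/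
def insertAt (j : Fin n) (y : Plane) (z : {k : Fin n // k ≠ j} → Plane) : Fin n → Plane :=
  fun k => if h : k = j then y else z ⟨k, h⟩

@[simp] lemma insertAt_self (j : Fin n) (y : Plane) (z : {k : Fin n // k ≠ j} → Plane) :
    insertAt j y z j = y := by simp [insertAt]

lemma insertAt_apply_ne {j k : Fin n} (h : k ≠ j) (y : Plane) (z : {k : Fin n // k ≠ j} → Plane) :
    insertAt j y z k = z ⟨k, h⟩ := by simp [insertAt, h]

lemma insertAt_eta (j : Fin n) (x : Fin n → Plane) : insertAt j (x j) (fun k => x k) = x := by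
  funext k
  by_cases h : k = j
  · subst h; simp
  · simp [insertAt_apply_ne h]

lemma Continuous.insertAt {A : Type*} [TopologicalSpace A] (j : Fin n) {y : A → Plane}
    {z : A → {k : Fin n // k ≠ j} → Plane} (hy : Continuous y) (hz : Continuous z) :
    Continuous fun a => insertAt j (y a) (z a) := by
  refine continuous_pi fun k => ?_
  by_cases h : k = j
  · subst h; simpa using hy
  · simp only [insertAt_apply_ne h]
    exact (continuous_apply _).comp hz

/-- The marginal of `g` with respect to the position of particle `j`. -/
noncomputable def marginal (j : Fin n) (g : (Fin n → Plane) → ℝ) (y : Plane) : ℝ :=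
  ∫ z : {k : Fin n // k ≠ j} → Plane, g (insertAt j y z)

/-- Splitting off the position of particle `j`. -/
noncomputable def splitAt (j : Fin n) :
    (Fin n → Plane) ≃ᵐ Plane × ({k : Fin n // k ≠ j} → Plane) :=
  (MeasurableEquiv.piEquivPiSubtypeProd (fun _ => Plane) (fun k => k = j)).trans
    ((MeasurableEquiv.funUnique {k : Fin n // k = j} Plane).prodCongr (MeasurableEquiv.refl _))

lemma splitAt_apply (j : Fin n) (x : Fin n → Plane) : splitAt j x = (x j, fun k : {k : Fin n // k ≠ j} => x k) :=
  rfl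

lemma measurePreserving_splitAt (j : Fin n) : MeasurePreserving (splitAt j) := by
  have hu : ∀ inst : Fintype {k : Fin n // k = j},
      MeasurePreserving (MeasurableEquiv.funUnique {k : Fin n // k = j} Plane)
        (@Measure.pi _ _ inst _ fun _ => volume) volume := by
    intro inst
    obtain rfl : inst = Unique.fintype := Subsingleton.elim _ _
    exact measurePreserving_funUnique volume _
  exact ((hu _).prod (MeasurePreserving.id _)).comp
    (measurePreserving_piEquivPiSubtypeProd (fun _ => (volume : Measure Plane)) (fun k => k = j))

variable {g : (Fin n → Plane) → ℝ} (j : Fin n)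

lemma hasCompactSupport_comp_insertAt (hgc : HasCompactSupport g) :
    HasCompactSupport fun p : Plane × ({k : Fin n // k ≠ j} → Plane) => g (insertAt j p.1 p.2) := by
  refine hgc.comp_of_leftInverse (r := fun x => (x j, fun k => x k)) (by fun_prop) fun p => ?_
  refine Prod.ext (by simp) (funext fun k => ?_)
  simp [insertAt_apply_ne k.2]

lemma setIntegral_marginal (hg : Continuous g) (hgc : HasCompactSupport g) (Q : Set Plane) :
    ∫ y in Q, marginal j g y = ∫ x in {x | x j ∈ Q}, g x := by
  have hc : Continuous fun p : Plane × ({k : Fin n // k ≠ j} → Plane) =>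
      g (insertAt j p.1 p.2) := hg.comp (continuous_fst.insertAt j continuous_snd)
  have hi := hc.integrable_of_hasCompactSupport (μ := volume)
    (hasCompactSupport_comp_insertAt j hgc)
  have h1 := (measurePreserving_splitAt j).setIntegral_preimage_emb
    (splitAt j).measurableEmbedding (fun p => g (insertAt j p.1 p.2)) (Q ×ˢ Set.univ)
  have h2 := setIntegral_prod (μ := (volume : Measure Plane))
    (ν := (volume : Measure ({k : Fin n // k ≠ j} → Plane))) (s := Q) (t := Set.univ)
    (fun p => g (insertAt j p.1 p.2)) hi.integrableOn
  simp only [Measure.restrict_univ] at h2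
  refine h2.symm.trans (h1.symm.trans ?_)
  simp only [splitAt_apply, insertAt_eta]
  congr 2
  ext x
  simp [splitAt_apply]

lemma hasCompactSupport_marginal (hgc : HasCompactSupport g) :
    HasCompactSupport (marginal j g) := by
  refine HasCompactSupport.intro (hgc.image (continuous_apply j)) fun y hy => ?_
  refine integral_eq_zero_of_ae (ae_of_all _ fun z => ?_)
  refine image_eq_zero_of_notMem_tsupport fun h => hy ⟨_, h, by simp⟩

lemma continuous_marginal (hg : Continuous g) (hgc : HasCompactSupport g) :
    Continuous (marginal j g) := by
  have hc : Continuous (Function.uncurry fun (y : Plane) (z : {k : Fin n // k ≠ j} → Plane) =>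
      g (insertAt j y z)) := hg.comp (continuous_fst.insertAt j continuous_snd)
  have hK : IsCompact ((fun x : Fin n → Plane => fun k : {k : Fin n // k ≠ j} => x k) ''
      tsupport g) := hgc.image (by fun_prop)
  convert continuous_parametric_integral_of_continuous (μ := volume) hc hK using 1
  funext y
  refine (setIntegral_eq_integral_of_forall_compl_eq_zero fun z hz => ?_).symm
  refine image_eq_zero_of_notMem_tsupport fun h => hz ⟨_, h, funext fun k => ?_⟩
  simp [insertAt_apply_ne k.2]

lemma integrable_marginal (hg : Continuous g) (hgc : HasCompactSupport g) :
    Integrable (marginal j g) :=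
  (continuous_marginal j hg hgc).integrable_of_hasCompactSupport (hasCompactSupport_marginal j hgc)

lemma marginal_nonneg (hg : ∀ x, 0 ≤ g x) (y : Plane) : 0 ≤ marginal j g y :=
  integral_nonneg fun _ => hg _

/-- Fubini's theorem along a curve of positions of particle `j`. -/
lemma setIntegral_curve_marginal (hg : Continuous g) (hgc : HasCompactSupport g) {γ : ℝ → Plane}
    (hγ : Continuous γ) {r : Plane → ℝ} (hr : Continuous r) (hrγ : Function.LeftInverse r γ)
    (S : Set ℝ) :
    ∫ u in S, marginal j g (γ u)
      = ∫ z, ∫ u in S, g (insertAt j (γ u) z) := by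
  refine integral_integral_swap_of_hasCompactSupport (f := fun u z => g (insertAt j (γ u) z))
    (hg.comp ((hγ.comp continuous_fst).insertAt j continuous_snd)) ?_
  refine hgc.comp_of_leftInverse (F := fun p : ℝ × ({k : Fin n // k ≠ j} → Plane) =>
    insertAt j (γ p.1) p.2) (r := fun x => (r (x j), fun k => x k)) (by fun_prop) fun p => ?_
  refine Prod.ext (by simp [hrγ p.1]) (funext fun k => ?_)
  simp [insertAt_apply_ne k.2]

lemma integrable_comp_insertAt (hg : Continuous g) (hgc : HasCompactSupport g) (y : Plane) :
    Integrable fun z => g (insertAt j y z) := by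
  refine (hg.comp (continuous_const.insertAt j continuous_id)).integrable_of_hasCompactSupport ?_
  refine hgc.comp_of_leftInverse (F := fun z => insertAt j y z)
    (r := fun x (k : {k : Fin n // k ≠ j}) => x k) (by fun_prop) fun z => funext fun k => ?_
  simp [insertAt_apply_ne k.2]

lemma integrable_setIntegral_insertAt (hg : Continuous g) (hgc : HasCompactSupport g)
    {γ : ℝ → Plane} (hγ : Continuous γ) {r : Plane → ℝ} (hr : Continuous r)
    (hrγ : Function.LeftInverse r γ) (S : Set ℝ) :
    Integrable fun z => ∫ u in S, g (insertAt j (γ u) z) := by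
  have hc : Continuous fun p : ℝ × ({k : Fin n // k ≠ j} → Plane) => g (insertAt j (γ p.1) p.2) :=
    hg.comp ((hγ.comp continuous_fst).insertAt j continuous_snd)
  have hcs : HasCompactSupport fun p : ℝ × ({k : Fin n // k ≠ j} → Plane) =>
      g (insertAt j (γ p.1) p.2) := by
    refine hgc.comp_of_leftInverse (F := fun p : ℝ × ({k : Fin n // k ≠ j} → Plane) =>
      insertAt j (γ p.1) p.2) (r := fun x => (r (x j), fun k => x k)) (by fun_prop) fun p => ?_
    refine Prod.ext (by simp [hrγ p.1]) (funext fun k => ?_)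
    simp [insertAt_apply_ne k.2]
  exact (hc.integrable_of_hasCompactSupport
    (μ := (volume.restrict S).prod volume) hcs).integral_prod_right

end Marginal

section PlanarBound

/-- A function on a rectangle whose oscillation in each variable is controlled has a controlled
`L²` norm. -/
lemma setIntegral_sq_le_mul {r c₀ c₁ : ℝ × ℝ → ℝ} (hr : Continuous r) (hc₀ : Continuous c₀)
    (hc₁ : Continuous c₁) (hr0 : ∀ p, 0 ≤ r p) {a b L : ℝ} (hL : 0 < L)
    (h₀ : ∀ t, ∀ s ∈ Set.Ico a (a + L), ∀ s' ∈ Set.Ico a (a + L),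
      r (s, t) ≤ r (s', t) + ∫ u in Set.Ico a (a + L), c₀ (u, t))
    (h₁ : ∀ s, ∀ t ∈ Set.Ico b (b + L), ∀ t' ∈ Set.Ico b (b + L),
      r (s, t) ≤ r (s, t') + ∫ u in Set.Ico b (b + L), c₁ (s, u)) :
    ∫ p in Set.Ico a (a + L) ×ˢ Set.Ico b (b + L), r p ^ 2
      ≤ ((∫ p in Set.Ico a (a + L) ×ˢ Set.Ico b (b + L), r p) / L
          + ∫ p in Set.Ico a (a + L) ×ˢ Set.Ico b (b + L), c₀ p)
        * ((∫ p in Set.Ico a (a + L) ×ˢ Set.Ico b (b + L), r p) / L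
          + ∫ p in Set.Ico a (a + L) ×ˢ Set.Ico b (b + L), c₁ p) := by
  have key : ∀ (f : ℝ → ℝ) (d K x : ℝ), Continuous f →
      (∀ s' ∈ Set.Ico d (d + L), x ≤ f s' + K) →
      x ≤ (∫ s' in Set.Ico d (d + L), f s') / L + K := by
    intro f d K x hf h
    have hi : IntegrableOn f (Set.Ico d (d + L)) :=
      (hf.continuousOn.integrableOn_compact isCompact_Icc).mono_set Set.Ico_subset_Icc_self
    have hk : ∀ k : ℝ, ∫ _ in Set.Ico d (d + L), k = L * k := fun k => by
      rw [setIntegral_const]; simp [hL.le]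
    have hck : ∀ k : ℝ, IntegrableOn (fun _ => k) (Set.Ico d (d + L)) := fun k =>
      (continuous_const.continuousOn.integrableOn_compact isCompact_Icc).mono_set
        Set.Ico_subset_Icc_self
    have h2 := setIntegral_mono_on (hck x) (hi.add (hck K)) measurableSet_Ico h
    simp only [Pi.add_apply] at h2
    rw [integral_add hi (hck K), hk, hk] at h2
    rw [← sub_le_iff_le_add, le_div_iff₀ hL]
    linarith
  set μ : Measure ℝ := volume.restrict (Set.Ico a (a + L)) with hμ
  set ν : Measure ℝ := volume.restrict (Set.Ico b (b + L)) with hν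
  have hprod : (volume : Measure (ℝ × ℝ)).restrict (Set.Ico a (a + L) ×ˢ Set.Ico b (b + L))
      = μ.prod ν := by rw [hμ, hν, Measure.prod_restrict]; rfl
  have hintg : ∀ f : ℝ × ℝ → ℝ, Continuous f → Integrable f (μ.prod ν) := by
    intro f hf
    rw [← hprod]
    exact (hf.continuousOn.integrableOn_compact (isCompact_Icc.prod isCompact_Icc)).mono_set
      (Set.prod_mono Set.Ico_subset_Icc_self Set.Ico_subset_Icc_self)
  set V : ℝ → ℝ := fun t => (∫ u, r (u, t) ∂μ) / L + ∫ u, c₀ (u, t) ∂μ with hV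
  set U : ℝ → ℝ := fun s => (∫ u, r (s, u) ∂ν) / L + ∫ u, c₁ (s, u) ∂ν with hU
  have hVi : Integrable V ν :=
    ((hintg r hr).integral_prod_right.div_const L).add (hintg c₀ hc₀).integral_prod_right
  have hUi : Integrable U μ :=
    ((hintg r hr).integral_prod_left.div_const L).add (hintg c₁ hc₁).integral_prod_left
  have hVint : ∫ t, V t ∂ν = (∫ p, r p ∂μ.prod ν) / L + ∫ p, c₀ p ∂μ.prod ν := by
    rw [hV, integral_add ((hintg r hr).integral_prod_right.div_const L)
      (hintg c₀ hc₀).integral_prod_right, integral_div, ← integral_prod_symm _ (hintg r hr),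
      ← integral_prod_symm _ (hintg c₀ hc₀)]
  have hUint : ∫ s, U s ∂μ = (∫ p, r p ∂μ.prod ν) / L + ∫ p, c₁ p ∂μ.prod ν := by
    rw [hU, integral_add ((hintg r hr).integral_prod_left.div_const L)
      (hintg c₁ hc₁).integral_prod_left, integral_div, ← integral_prod _ (hintg r hr),
      ← integral_prod _ (hintg c₁ hc₁)]
  rw [hprod, ← hVint, ← hUint, mul_comm, ← integral_prod_mul, ← hprod]
  refine setIntegral_mono_on ?_ ?_ (measurableSet_Ico.prod measurableSet_Ico) ?_
  · rw [IntegrableOn, hprod]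
    exact hintg _ (hr.fun_pow 2)
  · rw [IntegrableOn, hprod]
    exact hUi.mul_prod hVi
  · rintro ⟨s, t⟩ ⟨hs, ht⟩
    have hv : r (s, t) ≤ V t := key (fun u => r (u, t)) a _ _
      (hr.comp (by fun_prop)) (h₀ t s hs)
    have hu : r (s, t) ≤ U s := key (fun u => r (s, u)) b _ _
      (hr.comp (by fun_prop)) (h₁ s t ht)
    rw [sq]
    exact mul_le_mul hu hv (hr0 _) ((hr0 _).trans hu)

/-- Cartesian coordinates on the plane. -/
noncomputable def planeCoord : Plane ≃ᵐ ℝ × ℝ :=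
  (MeasurableEquiv.toLp 2 (Fin 2 → ℝ)).symm.trans MeasurableEquiv.finTwoArrow

lemma planeCoord_eta (y : Plane) : !₂[(planeCoord y).1, (planeCoord y).2] = y := by
  ext i; fin_cases i <;> rfl

lemma measurePreserving_planeCoord : MeasurePreserving planeCoord :=
  (volume_preserving_finTwoArrow ℝ).comp
    (EuclideanSpace.volume_preserving_symm_measurableEquiv_toLp (Fin 2))

lemma setIntegral_planeSquare (g : Plane → ℝ) (a b L : ℝ) :
    ∫ y in planeSquare a b L, g y
      = ∫ p in Set.Ico a (a + L) ×ˢ Set.Ico b (b + L), g !₂[p.1, p.2] := by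
  have h := measurePreserving_planeCoord.setIntegral_preimage_emb planeCoord.measurableEmbedding
    (fun p => g !₂[p.1, p.2]) (Set.Ico a (a + L) ×ˢ Set.Ico b (b + L))
  rw [← h]
  simp only [planeCoord_eta]
  rfl

lemma setIntegral_planeSquare_sq_le {r c₀ c₁ : Plane → ℝ} (hr : Continuous r)
    (hc₀ : Continuous c₀) (hc₁ : Continuous c₁) (hr0 : ∀ y, 0 ≤ r y) {a b L : ℝ} (hL : 0 < L)
    (h₀ : ∀ t, ∀ s ∈ Set.Ico a (a + L), ∀ s' ∈ Set.Ico a (a + L),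
      r !₂[s, t] ≤ r !₂[s', t] + ∫ u in Set.Ico a (a + L), c₀ !₂[u, t])
    (h₁ : ∀ s, ∀ t ∈ Set.Ico b (b + L), ∀ t' ∈ Set.Ico b (b + L),
      r !₂[s, t] ≤ r !₂[s, t'] + ∫ u in Set.Ico b (b + L), c₁ !₂[s, u]) :
    ∫ y in planeSquare a b L, r y ^ 2
      ≤ ((∫ y in planeSquare a b L, r y) / L + ∫ y in planeSquare a b L, c₀ y)
        * ((∫ y in planeSquare a b L, r y) / L + ∫ y in planeSquare a b L, c₁ y) := by
  have hp : Continuous fun p : ℝ × ℝ => (!₂[p.1, p.2] : Plane) := by fun_prop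
  simp only [setIntegral_planeSquare]
  exact setIntegral_sq_le_mul (hr.comp hp) (hc₀.comp hp) (hc₁.comp hp) (fun p => hr0 _) hL h₀ h₁

end PlanarBound

section Uncertainty

variable {α : ℝ} {n : ℕ} {ψ : (Fin n → Plane) → ℂ}

/-- The density of `∂ᵢ|ψ|²` that is controlled by the magnetic derivative of particle `j`. -/
noncomputable def gradBound (α : ℝ) {n : ℕ} (ψ : (Fin n → Plane) → ℂ) (j : Fin n) (i : Fin 2)
    (x : Fin n → Plane) : ℝ :=
  2 * (‖ψ x‖ * ‖anyonD α ψ x j i‖)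

lemma gradBound_nonneg (j : Fin n) (i : Fin 2) (x : Fin n → Plane) :
    0 ≤ gradBound α ψ j i x := by
  unfold gradBound; positivity

lemma continuous_gradBound (hψ : ContDiff ℝ (⊤ : ℕ∞) ψ)
    (hsupp : ∀ x ∈ tsupport ψ, ∀ j k : Fin n, j ≠ k → x j ≠ x k) (j : Fin n) (i : Fin 2) :
    Continuous (gradBound α ψ j i) :=
  continuous_const.mul (hψ.continuous.norm.mul (continuous_anyonD hψ hsupp j i).norm)

lemma hasCompactSupport_gradBound (hcs : HasCompactSupport ψ) (j : Fin n) (i : Fin 2) :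
    HasCompactSupport (gradBound α ψ j i) :=
  HasCompactSupport.intro hcs fun x hx => by
    simp [gradBound, image_eq_zero_of_notMem_tsupport hx]

lemma hasCompactSupport_norm_sq (hcs : HasCompactSupport ψ) :
    HasCompactSupport fun x => ‖ψ x‖ ^ 2 :=
  HasCompactSupport.intro hcs fun x hx => by
    simp [image_eq_zero_of_notMem_tsupport hx]

lemma insertAt_add (j : Fin n) (y v : Plane) (z : {k : Fin n // k ≠ j} → Plane) :
    insertAt j (y + v) z = insertAt j y z + Pi.single j v := by
  funext k
  by_cases h : k = j
  · subst h; simp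
  · simp [insertAt_apply_ne h, h]

/-- Moving particle `j` along a coordinate direction changes `|ψ|²` by at most the integral of
`gradBound`. -/
lemma norm_sq_insertAt_le (hψ : ContDiff ℝ (⊤ : ℕ∞) ψ)
    (hsupp : ∀ x ∈ tsupport ψ, ∀ j k : Fin n, j ≠ k → x j ≠ x k) (j : Fin n) (i : Fin 2)
    (y : Plane) (z : {k : Fin n // k ≠ j} → Plane) {a b s s' : ℝ}
    (hs : s ∈ Set.Icc a b) (hs' : s' ∈ Set.Icc a b) :
    ‖ψ (insertAt j (y + s • EuclideanSpace.single i (1 : ℝ)) z)‖ ^ 2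
      ≤ ‖ψ (insertAt j (y + s' • EuclideanSpace.single i (1 : ℝ)) z)‖ ^ 2
        + ∫ u in Set.Ico a b, gradBound α ψ j i
          (insertAt j (y + u • EuclideanSpace.single i (1 : ℝ)) z) := by
  set e : Plane := EuclideanSpace.single i (1 : ℝ) with he
  set γ : ℝ → Fin n → Plane := fun u => insertAt j (y + u • e) z with hγ
  have hγeq : γ = fun u => insertAt j y z + u • (Pi.single j e : Fin n → Plane) := by
    funext u
    rw [hγ, ← Pi.single_smul, ← insertAt_add]
  have hγd : ∀ u, HasDerivAt γ (Pi.single j e) u := by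
    intro u
    rw [hγeq]
    simpa using ((hasDerivAt_id u).smul_const (Pi.single j e : Fin n → Plane)).const_add
      (insertAt j y z)
  have hγc : Continuous γ := continuous_iff_continuousAt.mpr fun u => (hγd u).continuousAt
  have hd : ∀ u, HasDerivAt (fun u => ‖ψ (γ u)‖ ^ 2)
      (2 * inner ℝ (ψ (γ u)) (fderiv ℝ ψ (γ u) (Pi.single j e))) u := fun u =>
    ((((hψ.differentiable (by simp)) (γ u)).hasFDerivAt).comp_hasDerivAt u (hγd u)).norm_sq
  have hdc : Continuous fun u =>
      2 * inner ℝ (ψ (γ u)) (fderiv ℝ ψ (γ u) (Pi.single j e)) :=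
    continuous_const.mul ((hψ.continuous.comp hγc).inner
      (((hψ.continuous_fderiv (by simp)).comp hγc).clm_apply continuous_const))
  have hgc : Continuous fun u => gradBound α ψ j i (γ u) :=
    (continuous_gradBound hψ hsupp j i).comp hγc
  have hbd : ∀ u, ‖2 * inner ℝ (ψ (γ u)) (fderiv ℝ ψ (γ u) (Pi.single j e))‖
      ≤ gradBound α ψ j i (γ u) := fun u =>
    abs_inner_fderiv_le (γ u) _ _ (anyonA α (γ u) j i) rfl
  have hgi : IntegrableOn (fun u => gradBound α ψ j i (γ u)) (Set.Ioc a b) :=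
    (hgc.continuousOn.integrableOn_compact isCompact_Icc).mono_set Set.Ioc_subset_Icc_self
  have hsub : Set.uIoc s' s ⊆ Set.Ioc a b := by
    intro u hu
    rw [Set.mem_uIoc] at hu
    rcases hu with h | h
    · exact ⟨hs'.1.trans_lt h.1, h.2.trans hs.2⟩
    · exact ⟨hs.1.trans_lt h.1, h.2.trans hs'.2⟩
  have h1 := intervalIntegral.integral_eq_sub_of_hasDerivAt (a := s') (b := s)
    (fun u _ => hd u) (hdc.intervalIntegrable s' s)
  have h2 : ‖∫ u in s'..s, 2 * inner ℝ (ψ (γ u)) (fderiv ℝ ψ (γ u) (Pi.single j e))‖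
      ≤ ∫ u in Set.Ioc a b, gradBound α ψ j i (γ u) := by
    refine (intervalIntegral.norm_integral_le_integral_norm_uIoc).trans ?_
    refine (setIntegral_mono_on ?_ (hgi.mono_set hsub) measurableSet_uIoc fun u _ => hbd u).trans ?_
    · exact (hdc.norm.continuousOn.integrableOn_compact isCompact_uIcc).mono_set
        Set.uIoc_subset_uIcc
    · exact setIntegral_mono_set hgi (ae_of_all _ fun u => gradBound_nonneg j i _)
        hsub.eventuallyLE
  rw [integral_Ico_eq_integral_Ioc]
  have h3 := (abs_le.mp (Real.norm_eq_abs _ ▸ h2)).2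
  rw [h1] at h3
  linarith

lemma marginal_norm_sq_le (hψ : ContDiff ℝ (⊤ : ℕ∞) ψ) (hcs : HasCompactSupport ψ)
    (hsupp : ∀ x ∈ tsupport ψ, ∀ j k : Fin n, j ≠ k → x j ≠ x k) (j : Fin n) (i : Fin 2)
    (y : Plane) {a b s s' : ℝ} (hs : s ∈ Set.Icc a b) (hs' : s' ∈ Set.Icc a b) :
    marginal j (fun x => ‖ψ x‖ ^ 2) (y + s • EuclideanSpace.single i (1 : ℝ))
      ≤ marginal j (fun x => ‖ψ x‖ ^ 2) (y + s' • EuclideanSpace.single i (1 : ℝ))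
        + ∫ u in Set.Ico a b, marginal j (gradBound α ψ j i)
            (y + u • EuclideanSpace.single i (1 : ℝ)) := by
  have hfc := hψ.continuous.norm.fun_pow 2
  have hfs := hasCompactSupport_norm_sq hcs
  have hgc := continuous_gradBound (α := α) hψ hsupp j i
  have hgs := hasCompactSupport_gradBound (α := α) hcs j i
  have hγ : Continuous fun u : ℝ => y + u • (EuclideanSpace.single i (1 : ℝ) : Plane) := by
    fun_prop
  have hr : Continuous fun v : Plane => v i - y i := by fun_prop
  have hl : Function.LeftInverse (fun v : Plane => v i - y i)
      (fun u : ℝ => y + u • (EuclideanSpace.single i (1 : ℝ) : Plane)) := fun u => by simp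
  rw [setIntegral_curve_marginal j hgc hgs hγ hr hl]
  have hi := integrable_setIntegral_insertAt j hgc hgs hγ hr hl (Set.Ico a b)
  unfold marginal
  rw [← integral_add (integrable_comp_insertAt j hfc hfs _) hi]
  refine integral_mono (integrable_comp_insertAt j hfc hfs _)
    ((integrable_comp_insertAt j hfc hfs _).add hi) fun z => ?_
  exact norm_sq_insertAt_le hψ hsupp j i y z hs hs'

/-- The local uncertainty principle for the one-particle density, in product form. -/
lemma setIntegral_marginal_sq_le (hψ : ContDiff ℝ (⊤ : ℕ∞) ψ) (hcs : HasCompactSupport ψ)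
    (hsupp : ∀ x ∈ tsupport ψ, ∀ j k : Fin n, j ≠ k → x j ≠ x k) (j : Fin n) {a b L : ℝ}
    (hL : 0 < L) :
    ∫ y in planeSquare a b L, marginal j (fun x => ‖ψ x‖ ^ 2) y ^ 2
      ≤ ((∫ x in {x | x j ∈ planeSquare a b L}, ‖ψ x‖ ^ 2) / L
          + ∫ x in {x | x j ∈ planeSquare a b L}, gradBound α ψ j 0 x)
        * ((∫ x in {x | x j ∈ planeSquare a b L}, ‖ψ x‖ ^ 2) / L
          + ∫ x in {x | x j ∈ planeSquare a b L}, gradBound α ψ j 1 x) := by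
  have hfc := hψ.continuous.norm.fun_pow 2
  have hfs := hasCompactSupport_norm_sq hcs
  have hgc := continuous_gradBound (α := α) hψ hsupp j
  have hgs := hasCompactSupport_gradBound (α := α) hcs j
  simp only [← setIntegral_marginal j hfc hfs, ← setIntegral_marginal j (hgc _) (hgs _)]
  have e0 : ∀ t u : ℝ, (!₂[u, t] : Plane) = !₂[0, t] + u • EuclideanSpace.single 0 (1 : ℝ) := by
    intro t u
    ext i; fin_cases i <;> simp
  have e1 : ∀ s u : ℝ, (!₂[s, u] : Plane) = !₂[s, 0] + u • EuclideanSpace.single 1 (1 : ℝ) := by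
    intro s u
    ext i; fin_cases i <;> simp
  refine setIntegral_planeSquare_sq_le (continuous_marginal j hfc hfs)
    (continuous_marginal j (hgc 0) (hgs 0)) (continuous_marginal j (hgc 1) (hgs 1))
    (marginal_nonneg j fun x => by positivity) hL ?_ ?_
  · intro t s hs s' hs'
    simpa only [← e0 t] using marginal_norm_sq_le (α := α) hψ hcs hsupp j 0 !₂[0, t] (Set.Ico_subset_Icc_self hs)
      (Set.Ico_subset_Icc_self hs')
  · intro s t ht t' ht'
    simpa only [← e1 s] using marginal_norm_sq_le (α := α) hψ hcs hsupp j 1 !₂[s, 0] (Set.Ico_subset_Icc_self ht)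
      (Set.Ico_subset_Icc_self ht')

/-- The local uncertainty principle for the one-particle density. -/
lemma local_uncertainty (hψ : ContDiff ℝ (⊤ : ℕ∞) ψ) (hcs : HasCompactSupport ψ)
    (hsupp : ∀ x ∈ tsupport ψ, ∀ j k : Fin n, j ≠ k → x j ≠ x k) (j : Fin n) {a b L : ℝ}
    (hL : 0 < L) :
    ∫ y in planeSquare a b L, marginal j (fun x => ‖ψ x‖ ^ 2) y ^ 2
      ≤ 10 * ((∫ x in {x | x j ∈ planeSquare a b L}, ‖ψ x‖ ^ 2)
          * ∫ x in {x | x j ∈ planeSquare a b L}, anyonEnergy α ψ j x)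
        + 5 / 4 * ((∫ x in {x | x j ∈ planeSquare a b L}, ‖ψ x‖ ^ 2) / L) ^ 2 := by
  refine (setIntegral_marginal_sq_le (α := α) hψ hcs hsupp j hL).trans ?_
  set S : Set (Fin n → Plane) := {x | x j ∈ planeSquare a b L} with hS
  have hfi : IntegrableOn (fun x => ‖ψ x‖ ^ 2) S :=
    ((hψ.continuous.norm.fun_pow 2).integrable_of_hasCompactSupport
      (hasCompactSupport_norm_sq hcs)).integrableOn
  have hei : IntegrableOn (anyonEnergy α ψ j) S :=
    ((continuous_anyonEnergy hψ hsupp j).integrable_of_hasCompactSupport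
      (hasCompactSupport_anyonEnergy hcs j)).integrableOn
  have hgi : ∀ i, IntegrableOn (gradBound α ψ j i) S := fun i =>
    ((continuous_gradBound hψ hsupp j i).integrable_of_hasCompactSupport
      (hasCompactSupport_gradBound hcs j i)).integrableOn
  set m := ∫ x in S, ‖ψ x‖ ^ 2 with hm
  set T := ∫ x in S, anyonEnergy α ψ j x with hT
  set B₀ := ∫ x in S, gradBound α ψ j 0 x with hB₀
  set B₁ := ∫ x in S, gradBound α ψ j 1 x with hB₁
  have hcs' : ∀ ε : ℝ, 0 ≤ (2 * m) * (ε * ε) + (-(B₀ + B₁)) * ε + T := by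
    intro ε
    have h : (2 * m) * (ε * ε) + (-(B₀ + B₁)) * ε + T
        = ∫ x in S, ((2 * (ε * ε)) * ‖ψ x‖ ^ 2
          + (-ε) * (gradBound α ψ j 0 x + gradBound α ψ j 1 x) + anyonEnergy α ψ j x) := by
      have hsum : Integrable (fun x => (-ε) * (gradBound α ψ j 0 x + gradBound α ψ j 1 x))
          (volume.restrict S) := ((hgi 0).add (hgi 1)).const_mul _
      rw [integral_add (Integrable.fun_add (hfi.const_mul _) hsum) hei,
        integral_add (hfi.const_mul _) hsum,
        integral_const_mul, integral_const_mul, integral_add (hgi 0) (hgi 1)]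
      ring
    rw [h]
    refine integral_nonneg fun x => ?_
    simp only [gradBound, anyonEnergy, Fin.sum_univ_two, Pi.zero_apply]
    nlinarith [sq_nonneg (ε * ‖ψ x‖ - ‖anyonD α ψ x j 0‖),
      sq_nonneg (ε * ‖ψ x‖ - ‖anyonD α ψ x j 1‖)]
  have hdisc := discrim_le_zero hcs'
  rw [discrim] at hdisc
  nlinarith [sq_nonneg (B₀ - B₁), sq_nonneg ((B₀ + B₁) - m / L / 2)]

end Uncertainty

section Global

variable {α : ℝ} {n : ℕ} {ψ : (Fin n → Plane) → ℂ}

lemma integral_anyonEnergy_eq (hψ : ContDiff ℝ (⊤ : ℕ∞) ψ)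
    (hsym : ∀ (σ : Equiv.Perm (Fin n)) (x : Fin n → Plane), ψ (x ∘ σ) = ψ x) (j k : Fin n) :
    ∫ x, anyonEnergy α ψ k x = ∫ x, anyonEnergy α ψ j x := by
  have hemb : MeasurableEmbedding fun x : Fin n → Plane => x ∘ Equiv.swap j k := by
    rw [← coe_piCongrLeft_perm_symm]
    exact MeasurableEquiv.measurableEmbedding _
  have h := (measurePreserving_comp_perm (Equiv.swap j k)).integral_comp hemb
    (anyonEnergy α ψ j)
  simp only [anyonEnergy_comp_perm hψ hsym, Equiv.swap_apply_left] at h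
  exact h

lemma exists_planeSquare_forall_mem (hcs : HasCompactSupport ψ) (j : Fin n) :
    ∃ a b L : ℝ, 0 < L ∧ ∀ x ∈ tsupport ψ, x j ∈ planeSquare a b L := by
  have hK : IsCompact ((fun x : Fin n → Plane => x j) '' tsupport ψ) :=
    hcs.image (continuous_apply j)
  obtain ⟨A, hA⟩ := hK.isBounded.exists_norm_le
  have hA' : ∀ x ∈ tsupport ψ, ∀ i, |x j i| < |A| + 1 := by
    intro x hx i
    have h1 := hA _ ⟨x, hx, rfl⟩
    have h2 := PiLp.norm_apply_le (x j) i
    rw [Real.norm_eq_abs] at h2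
    have h3 := le_abs_self A
    simp only [] at h1
    linarith
  refine ⟨-(|A| + 1), -(|A| + 1), 2 * (|A| + 1), by positivity, fun x hx => ?_⟩
  have h0 := abs_lt.mp (hA' x hx 0)
  have h1 := abs_lt.mp (hA' x hx 1)
  exact ⟨⟨h0.1.le, by linarith⟩, h1.1.le, by linarith⟩

lemma setIntegral_planeSquare_le {g : Plane → ℝ} (hg : Integrable g) {M : ℝ}
    (hM : ∀ y, g y ≤ M) (a b : ℝ) {L : ℝ} (hL : 0 < L) :
    ∫ y in planeSquare a b L, g y ≤ M * L ^ 2 := by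
  have hvol : volume (planeSquare a b L) = ENNReal.ofReal (L ^ 2) := by
    have h := measurePreserving_planeCoord.measure_preimage_equiv
      (Set.Ico a (a + L) ×ˢ Set.Ico b (b + L))
    refine h.trans ?_
    rw [Measure.volume_eq_prod, Measure.prod_prod, Real.volume_Ico, Real.volume_Ico,
      ← ENNReal.ofReal_mul (by linarith)]
    congr 1
    ring
  have hfin : volume (planeSquare a b L) ≠ ⊤ := by rw [hvol]; exact ENNReal.ofReal_ne_top
  refine (setIntegral_mono_on hg.integrableOn (integrableOn_const hfin)
    (measurableSet_planeSquare a b L) fun y _ => hM y).trans_eq ?_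
  rw [setIntegral_const, Measure.real, hvol, ENNReal.toReal_ofReal (by positivity), smul_eq_mul,
    mul_comm]

lemma kinetic_energy_bound (hn : 2 ≤ n) (hψ : ContDiff ℝ (⊤ : ℕ∞) ψ) (hcs : HasCompactSupport ψ)
    (hsym : ∀ (σ : Equiv.Perm (Fin n)) (x : Fin n → Plane), ψ (x ∘ σ) = ψ x)
    (hnorm : ∫ x, ‖ψ x‖ ^ 2 = 1)
    (hsupp : ∀ x ∈ tsupport ψ, ∀ j k : Fin n, j ≠ k → x j ≠ x k) (j : Fin n) :
    Calpha α n ^ 2 * (∫ y, (n * marginal j (fun x => ‖ψ x‖ ^ 2) y) ^ 2) / 5000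
      ≤ n * ∫ x, anyonEnergy α ψ j x := by
  have hfc := hψ.continuous.norm.fun_pow 2
  have hfs := hasCompactSupport_norm_sq hcs
  have hec := continuous_anyonEnergy (α := α) hψ hsupp j
  have hes := hasCompactSupport_anyonEnergy (α := α) hcs j
  set ρ : Plane → ℝ := marginal j fun x => ‖ψ x‖ ^ 2 with hρ
  have hρc : Continuous ρ := continuous_marginal j hfc hfs
  have hρs : HasCompactSupport ρ := hasCompactSupport_marginal j hfs
  have hρi : Integrable ρ := integrable_marginal j hfc hfs
  have hρ0 : ∀ y, 0 ≤ ρ y := marginal_nonneg j fun x => by positivity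
  have hτi : Integrable (marginal j (anyonEnergy α ψ j)) := integrable_marginal j hec hes
  have hτ0 := marginal_nonneg j (anyonEnergy_nonneg α ψ j)
  have hρ2i : Integrable fun y => (n * ρ y) ^ 2 := by
    refine ((continuous_const.mul hρc).pow 2).integrable_of_hasCompactSupport ?_
    refine HasCompactSupport.intro hρs fun y hy => ?_
    simp [image_eq_zero_of_notMem_tsupport hy]
  obtain ⟨M, hM⟩ := hρs.exists_bound_of_continuous hρc
  obtain ⟨a, b, L, hL, hQ⟩ := exists_planeSquare_forall_mem hcs j
  have hroot : ∀ g : (Fin n → Plane) → ℝ, (∀ x, x ∉ tsupport ψ → g x = 0) →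
      ∫ x in {x | x j ∈ planeSquare a b L}, g x = ∫ x, g x := fun g hg =>
    setIntegral_eq_integral_of_forall_compl_eq_zero fun x hx => hg x fun h => hx (hQ x h)
  have hmroot : ∫ x in {x | x j ∈ planeSquare a b L}, ‖ψ x‖ ^ 2 = 1 := by
    rw [hroot _ fun x hx => by simp [image_eq_zero_of_notMem_tsupport hx], hnorm]
  have hTroot := hroot (anyonEnergy α ψ j) fun x hx => by
    simp [anyonEnergy, anyonD_eq_zero_of_notMem hx]
  have hRroot : ∫ y in planeSquare a b L, (n * ρ y) ^ 2 = ∫ y, (n * ρ y) ^ 2 := by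
    refine setIntegral_eq_integral_of_forall_compl_eq_zero fun y hy => ?_
    have : ρ y = 0 := by
      refine integral_eq_zero_of_ae (ae_of_all _ fun z => ?_)
      have : insertAt j y z ∉ tsupport ψ := fun h => hy (by simpa using hQ _ h)
      simp [image_eq_zero_of_notMem_tsupport this]
    simp [this]
  have hn2 : (2 : ℝ) ≤ n := by exact_mod_cast hn
  have h := covering_bound (c := Calpha α n ^ 2) (M := n * M) (a := a) (b := b)
    (m := fun a b L => ∫ y in planeSquare a b L, n * ρ y)
    (T := fun a b L => ∫ y in planeSquare a b L, n * marginal j (anyonEnergy α ψ j) y)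
    (R := fun a b L => ∫ y in planeSquare a b L, (n * ρ y) ^ 2)
    (sq_nonneg _) (pow_le_one₀ (Calpha_nonneg α n) (Calpha_le_one α n))
    (quadAdditive_setIntegral (hρi.const_mul _)) (quadAdditive_setIntegral (hτi.const_mul _))
    (quadAdditive_setIntegral hρ2i)
    (fun a b L => integral_nonneg fun y => mul_nonneg (by positivity) (hρ0 y))
    (fun a b L => integral_nonneg fun y => mul_nonneg (by positivity) (hτ0 y))
    (fun a b L hL => setIntegral_planeSquare_le (hρi.const_mul _) (fun y =>
      mul_le_mul_of_nonneg_left ((le_abs_self _).trans (hM y)) (by positivity)) a b hL)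
    (fun a b L hL => by
      have := mul_le_mul_of_nonneg_left
        (local_uncertainty (α := α) hψ hcs hsupp j (a := a) (b := b) hL) (sq_nonneg (n : ℝ))
      simp only [mul_pow, integral_const_mul, hρ, setIntegral_marginal j hfc hfs,
        setIntegral_marginal j hec hes, mul_div_assoc]
      linarith)
    (fun a b L hL => by
      simpa only [integral_const_mul, hρ, setIntegral_marginal j hfc hfs,
        setIntegral_marginal j hec hes] using
        local_exclusion (α := α) hψ hcs hsym hsupp hnorm j (a := a) (b := b) hL)
    hL (by
      simp only [integral_const_mul, hρ, setIntegral_marginal j hfc hfs, hmroot]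
      linarith)
  simp only [integral_const_mul (n : ℝ), setIntegral_marginal j hec hes, hTroot, hRroot] at h
  have h0 : 0 ≤ Calpha α n ^ 2 * (1 / L ^ 2) := by positivity
  linarith

end Global

/-- **Kinetic energy (Lieb–Thirring) inequality for anyons.** For a normalized symmetric
`N`-anyon wave function `ψ` supported away from the diagonals, with one-particle density
`ρ(x) = N ∫ |ψ(x, x₂, …, x_N)|² dx₂⋯dx_N`,
`(1/2)∫ ∑_j ‖D_jψ‖² ≥ 10⁻⁴·C_{α,N}²·∫_{ℝ²} ρ²`. -/
theorem kinetic_energy_inequality_anyons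
    (α : ℝ) (N : ℕ) (hN : 2 ≤ N)
    (ψ : (Fin N → EuclideanSpace ℝ (Fin 2)) → ℂ)
    (hψ : ContDiff ℝ (⊤ : ℕ∞) ψ) (hcs : HasCompactSupport ψ)
    (hsym : ∀ (σ : Equiv.Perm (Fin N)) (x : Fin N → EuclideanSpace ℝ (Fin 2)),
      ψ (x ∘ σ) = ψ x)
    (hnorm : ∫ x : Fin N → EuclideanSpace ℝ (Fin 2), ‖ψ x‖ ^ 2 = 1)
    (hsupp : ∀ x ∈ tsupport ψ, ∀ j k : Fin N, j ≠ k → x j ≠ x k) :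
    (1 / 2) * (∫ x : Fin N → EuclideanSpace ℝ (Fin 2),
        ∑ j : Fin N, ∑ i : Fin 2, ‖anyonD α ψ x j i‖ ^ 2)
      ≥ 1e-4 * Calpha α N ^ 2 *
        ∫ y : EuclideanSpace ℝ (Fin 2),
          ((N : ℝ) * densityAt ψ (⟨0, by omega⟩ : Fin N) y) ^ 2 := by
  have h := kinetic_energy_bound (α := α) hN hψ hcs hsym hnorm hsupp ⟨0, by omega⟩
  have hE : ∫ x : Fin N → EuclideanSpace ℝ (Fin 2),
      ∑ j : Fin N, ∑ i : Fin 2, ‖anyonD α ψ x j i‖ ^ 2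
        = N * ∫ x, anyonEnergy α ψ ⟨0, by omega⟩ x := by
    have hsum := integral_finsetSum (μ := volume) Finset.univ
      (f := fun j x => anyonEnergy α ψ j x) fun j _ =>
      (continuous_anyonEnergy hψ hsupp j).integrable_of_hasCompactSupport
        (hasCompactSupport_anyonEnergy hcs j)
    refine hsum.trans ?_
    rw [Finset.sum_congr rfl fun k _ => integral_anyonEnergy_eq (α := α) hψ hsym ⟨0, by omega⟩ k,
      Finset.sum_const, Finset.card_univ, Fintype.card_fin, nsmul_eq_mul]
  have hρ : ∀ y, densityAt ψ (⟨0, by omega⟩ : Fin N) y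
      = marginal ⟨0, by omega⟩ (fun x => ‖ψ x‖ ^ 2) y := fun y => rfl
  rw [hE]
  simp only [hρ]
  norm_num at h ⊢
  linarith
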